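/- arXiv:1306.4774 — 10 statements merged into one kernel-verified Lean document; each statement's English description precedes it below -/
import Mathlib

section
/- Let g_1, …, g_n ∈ F_q^k, fix i ∈ {1,…,n}, and let R_1, …, R_{δ−1} ⊆ {1,…,n}\{i} be pairwise disjoint sets with g_i ∈ span{g_t : t ∈ R_j} for each j = 1, …, δ−1. Let S ⊆ {1,…,n} and set N = {i} ∪ R_1 ∪ ⋯ ∪ R_{δ−1}. Then rank(S ∪ N) − rank(S) ≤ |N \ S| − (δ−1), provided g_i ∉ span(S) and N ∩ S = ∅. -/
/-- If a nonzero `g i` lies in the span of a family indexed by `R`, then some member of the family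
can be exchanged for `g i` without losing it from the span. -/
theorem exists_mem_span_insert_image_erase {F V ι : Type*} [Field F] [AddCommGroup V] [Module F V]
    [DecidableEq ι] {g : ι → V} {i : ι} (hi : g i ≠ 0) {R : Finset ι}
    (hR : g i ∈ Submodule.span F (g '' ↑R)) :
    ∃ t ∈ R, g t ∈ Submodule.span F (g '' ↑(insert i (R.erase t))) := by
  induction R using Finset.induction_on with
  | empty => simp_all
  | insert a R ha ih =>
    by_cases h : g i ∈ Submodule.span F (g '' ↑R)
    · obtain ⟨t, ht, hspan⟩ := ih h
      refine ⟨t, Finset.mem_insert_of_mem ht, Submodule.span_mono (Set.image_mono ?_) hspan⟩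
      exact_mod_cast Finset.insert_subset_insert i
        (Finset.erase_subset_erase t (Finset.subset_insert a R))
    · refine ⟨a, Finset.mem_insert_self a R, ?_⟩
      rw [Finset.coe_insert, Set.image_insert_eq] at hR
      rw [Finset.erase_insert ha, Finset.coe_insert, Set.image_insert_eq]
      exact mem_span_insert_exchange hR h

/-- Adjoining the vectors indexed by `T` raises the rank by at most `T.card`. -/
theorem finrank_span_image_union_le {F V ι : Type*} [Field F] [AddCommGroup V] [Module F V]
    [DecidableEq ι] (g : ι → V) (S T : Finset ι) :
    Module.finrank F (Submodule.span F (g '' ↑(S ∪ T))) ≤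
      Module.finrank F (Submodule.span F (g '' ↑S)) + T.card := by
  classical
  have hfin (U : Finset ι) : FiniteDimensional F (Submodule.span F (g '' ↑U)) :=
    FiniteDimensional.span_of_finite F (U.finite_toSet.image g)
  have := hfin S
  have := hfin T
  have hcard : Module.finrank F (Submodule.span F (g '' ↑T)) ≤ T.card := by
    rw [← Finset.coe_image]
    exact (finrank_span_finset_le_card _).trans Finset.card_image_le
  rw [Finset.coe_union, Set.image_union, Submodule.span_union]
  exact (Submodule.finrank_add_le_finrank_add_finrank _ _).trans (Nat.add_le_add_left hcard _)


/-- If `g i` lies in the span of each of `δ - 1` pairwise disjoint repair sets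
`R 1, …, R (δ-1) ⊆ {1,…,n} \ {i}`, `N = {i} ∪ R 1 ∪ ⋯ ∪ R (δ-1)`, `S` is
disjoint from `N` and `g i ∉ span S`, then
`rank(S ∪ N) - rank(S) ≤ |N \ S| - (δ - 1)`. -/
theorem stmt3 {F : Type*} [Field F] {n k δ : ℕ} (hδ : 2 ≤ δ)
    (g : Fin n → Fin k → F) (i : Fin n)
    (R : Fin (δ - 1) → Finset (Fin n))
    (hiR : ∀ j, i ∉ R j)
    (hdisj : Pairwise fun a b => Disjoint (R a) (R b))
    (hspan : ∀ j, g i ∈ Submodule.span F (g '' ↑(R j)))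
    (S : Finset (Fin n))
    (hgi : g i ∉ Submodule.span F (g '' ↑S))
    (N : Finset (Fin n)) (hN : N = insert i (Finset.univ.biUnion R))
    (hNS : Disjoint N S) :
    (Module.finrank F (Submodule.span F (g '' ↑(S ∪ N))) : ℤ)
        - (Module.finrank F (Submodule.span F (g '' ↑S)) : ℤ)
      ≤ ((N \ S).card : ℤ) - ((δ : ℤ) - 1) := by
  have hi : g i ≠ 0 := fun h => hgi (h ▸ Submodule.zero_mem _)
  choose t htR ht using fun j => exists_mem_span_insert_image_erase hi (hspan j)
  have htinj : Function.Injective t := fun a b hab => by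
    by_contra hne
    exact Finset.disjoint_left.mp (hdisj hne) (htR a) (hab ▸ htR b)
  set T := Finset.univ.image t
  have hTcard : T.card = δ - 1 := by
    simp [T, Finset.card_image_of_injective _ htinj]
  have hTN : T ⊆ N := by
    intro x hx
    obtain ⟨j, -, rfl⟩ := Finset.mem_image.mp hx
    exact hN ▸ Finset.mem_insert_of_mem (Finset.mem_biUnion.mpr ⟨j, Finset.mem_univ j, htR j⟩)
  have hsub (j) : insert i ((R j).erase (t j)) ⊆ N \ T := by
    intro x hx
    rw [Finset.mem_sdiff, hN]
    rcases Finset.mem_insert.mp hx with rfl | hx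
    · refine ⟨Finset.mem_insert_self _ _, fun hxT => ?_⟩
      obtain ⟨l, -, rfl⟩ := Finset.mem_image.mp hxT
      exact hiR l (htR l)
    · obtain ⟨hne, hxR⟩ := Finset.mem_erase.mp hx
      refine ⟨Finset.mem_insert_of_mem (Finset.mem_biUnion.mpr ⟨j, Finset.mem_univ j, hxR⟩),
        fun hxT => ?_⟩
      obtain ⟨l, -, rfl⟩ := Finset.mem_image.mp hxT
      have hlj : l ≠ j := fun h => hne (h ▸ rfl)
      exact Finset.disjoint_left.mp (hdisj hlj) (htR l) hxR
  have hle : Submodule.span F (g '' ↑(S ∪ N)) ≤ Submodule.span F (g '' ↑(S ∪ N \ T)) := by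
    rw [Submodule.span_le]
    rintro _ ⟨x, hx, rfl⟩
    by_cases hxT : x ∈ T
    · obtain ⟨j, -, rfl⟩ := Finset.mem_image.mp hxT
      refine Submodule.span_mono (Set.image_mono ?_) (ht j)
      exact_mod_cast (hsub j).trans Finset.subset_union_right
    · refine Submodule.subset_span (Set.mem_image_of_mem g ?_)
      simp only [Finset.mem_coe, Finset.mem_union, Finset.mem_sdiff] at hx ⊢
      tauto
  have hrank := (Submodule.finrank_mono hle).trans (finrank_span_image_union_le g S (N \ T))
  have hcard := Finset.card_sdiff_add_card_eq_card hTN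
  rw [Finset.sdiff_eq_self_of_disjoint hNS]
  omega
end

section
/- Let C be an [n,k,d]_q linear code with information (r,δ)_c-locality, where 2 ≤ r < k and δ ≥ 2. Then n ≥ d + k − 1 + μ, where μ = ⌈((k−1)(δ−1)+1)/((r−1)(δ−1)+1)⌉ − 1. -/
open Matrix

section ColumnRank

variable {F V ι : Type*} [Field F] [AddCommGroup V] [Module F V]

/-- The dimension of the span of the vectors indexed by `S`. -/
noncomputable def columnRank (F : Type*) {V ι : Type*} [Field F] [AddCommGroup V] [Module F V]
    (v : ι → V) (S : Finset ι) : ℕ :=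
  Module.finrank F (Submodule.span F (v '' ↑S))

theorem columnRank_empty (v : ι → V) : columnRank F v ∅ = 0 := by
  unfold columnRank
  rw [Finset.coe_empty, Set.image_empty, Submodule.span_empty, finrank_bot]

theorem notMem_of_notMem_span_image {v : ι → V} {i : ι} {S : Finset ι}
    (h : v i ∉ Submodule.span F (v '' ↑S)) : i ∉ S :=
  fun hi => h (Submodule.subset_span ⟨i, hi, rfl⟩)

theorem exists_notMem_span_of_columnRank_lt [FiniteDimensional F V] {v : ι → V} {I S : Finset ι}
    (h : columnRank F v S < columnRank F v I) :
    ∃ i ∈ I, v i ∉ Submodule.span F (v '' ↑S) := by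
  by_contra! hc
  refine h.not_ge (Submodule.finrank_mono (Submodule.span_le.2 ?_))
  rintro _ ⟨i, hi, rfl⟩
  exact hc i hi

variable [DecidableEq ι]

theorem columnRank_union_le [FiniteDimensional F V] (v : ι → V) (U Q : Finset ι) :
    columnRank F v (U ∪ Q) ≤ columnRank F v U + Q.card := by
  classical
  unfold columnRank
  rw [Finset.coe_union, Set.image_union, Submodule.span_union]
  refine (Submodule.finrank_add_le_finrank_add_finrank _ _).trans ?_
  gcongr
  rw [← Finset.coe_image]
  exact (finrank_span_finset_le_card _).trans Finset.card_image_le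

theorem columnRank_add_card_le [FiniteDimensional F V] (v : ι → V) {U W : Finset ι}
    (h : U ⊆ W) : columnRank F v W + U.card ≤ columnRank F v U + W.card := by
  have h1 := columnRank_union_le (F := F) v U (W \ U)
  rw [Finset.union_sdiff_of_subset h] at h1
  have h2 := Finset.card_sdiff_add_card_eq_card h
  omega

theorem columnRank_insert_le [FiniteDimensional F V] (v : ι → V) (i : ι) (S : Finset ι) :
    columnRank F v (insert i S) ≤ columnRank F v S + 1 := by
  have h := columnRank_union_le (F := F) v S {i}
  rwa [Finset.union_comm, ← Finset.insert_eq, Finset.card_singleton] at h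

/-- A spanning set of `v i` contains an element outside `S` that becomes redundant
once `v i` is adjoined to `S`, provided `v i` is not spanned by `S`. -/
theorem exists_mem_span_insert_union_erase {v : ι → V} {i : ι} {S R : Finset ι}
    (hS : v i ∉ Submodule.span F (v '' ↑S)) (hR : v i ∈ Submodule.span F (v '' ↑R)) :
    ∃ j ∈ R, j ∉ S ∧ v j ∈ Submodule.span F (v '' ↑(insert i S ∪ R.erase j)) := by
  classical
  obtain ⟨Q, hQ, hmax⟩ := Finset.exists_max_image
    (R.powerset.filter fun Q => v i ∉ Submodule.span F (v '' ↑(S ∪ Q))) Finset.card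
    ⟨∅, by simpa using hS⟩
  simp only [Finset.mem_filter, Finset.mem_powerset] at hQ hmax
  obtain ⟨hQR, hQ⟩ := hQ
  obtain ⟨j, hjR, hj⟩ : ∃ j ∈ R, j ∉ S ∪ Q := by
    by_contra! hc
    refine hQ (Submodule.span_mono (Set.image_mono ?_) hR)
    exact_mod_cast fun x hx => hc x hx
  have hjS : j ∉ S := fun h => hj (Finset.mem_union_left _ h)
  have hjQ : j ∉ Q := fun h => hj (Finset.mem_union_right _ h)
  have hi : v i ∈ Submodule.span F (v '' ↑(S ∪ insert j Q)) := by
    by_contra hc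
    have := hmax (insert j Q) ⟨Finset.insert_subset hjR hQR, hc⟩
    rw [Finset.card_insert_of_notMem hjQ] at this
    omega
  rw [Finset.union_insert, Finset.coe_insert, Set.image_insert_eq] at hi
  refine ⟨j, hjR, hjS, ?_⟩
  have hex := mem_span_insert_exchange hi hQ
  rw [← Set.image_insert_eq, ← Finset.coe_insert] at hex
  refine Submodule.span_mono (Set.image_mono ?_) hex
  intro x hx
  simp only [Finset.mem_coe, Finset.mem_insert, Finset.mem_union, Finset.mem_erase] at hx ⊢
  rcases hx with hx | hx | hx
  · exact Or.inl (Or.inl hx)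
  · exact Or.inl (Or.inr hx)
  · exact Or.inr ⟨fun h => hjQ (h ▸ hx), hQR hx⟩

/-- Adjoining a repair set of `i` to a set containing `i` creates a dependency. -/
theorem columnRank_union_repair [FiniteDimensional F V] {v : ι → V} {i : ι} {S R U : Finset ι}
    (hS : v i ∉ Submodule.span F (v '' ↑S)) (hR : v i ∈ Submodule.span F (v '' ↑R))
    (hU : insert i S ⊆ U) (hRU : R ∩ U ⊆ S) :
    columnRank F v (U ∪ R) + 1 ≤ columnRank F v U + R.card ∧
      columnRank F v (U ∪ R) + U.card + 1 ≤ columnRank F v U + (U ∪ R).card := by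
  obtain ⟨j, hjR, hjS, hj⟩ := exists_mem_span_insert_union_erase hS hR
  have hjU : j ∉ U := fun h => hjS (hRU (Finset.mem_inter.2 ⟨hjR, h⟩))
  have hins : U ∪ R = insert j (U ∪ R.erase j) := by
    rw [← Finset.union_insert, Finset.insert_erase hjR]
  have hrank : columnRank F v (U ∪ R) = columnRank F v (U ∪ R.erase j) := by
    unfold columnRank
    rw [hins, Finset.coe_insert, Set.image_insert_eq, Submodule.span_insert_eq_span]
    refine Submodule.span_mono (Set.image_mono ?_) hj
    exact_mod_cast Finset.union_subset_union_left hU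
  have hcard : (U ∪ R).card = (U ∪ R.erase j).card + 1 := by
    rw [hins, Finset.card_insert_of_notMem]
    simp [hjU]
  have h1 := columnRank_union_le (F := F) v U (R.erase j)
  have h2 := columnRank_add_card_le (F := F) v (Finset.subset_union_left (s₁ := U) (s₂ := R.erase j))
  have h3 := Finset.card_erase_add_one hjR
  omega

/-- Rank and nullity growth when `i` and a family of disjoint repair sets are adjoined to `S`. -/
theorem columnRank_insert_union_biUnion [FiniteDimensional F V] {κ : Type*} [DecidableEq κ]
    {v : ι → V} {i : ι} {S : Finset ι} {r : ℕ} {R : κ → Finset ι}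
    (hS : v i ∉ Submodule.span F (v '' ↑S)) (hi : ∀ ξ, i ∉ R ξ)
    (hdisj : Pairwise fun ξ η => Disjoint (R ξ) (R η)) (hcard : ∀ ξ, (R ξ).card ≤ r + 1)
    (hR : ∀ ξ, v i ∈ Submodule.span F (v '' ↑(R ξ))) (P : Finset κ) :
    columnRank F v (insert i S ∪ P.biUnion R) ≤ columnRank F v S + 1 + P.card * r ∧
      columnRank F v (insert i S ∪ P.biUnion R) + S.card + P.card ≤
        (insert i S ∪ P.biUnion R).card + columnRank F v S := by
  induction P using Finset.induction_on with
  | empty =>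
    have h1 := columnRank_insert_le (F := F) v i S
    have h2 := Finset.card_insert_of_notMem (notMem_of_notMem_span_image hS)
    simp only [Finset.biUnion_empty, Finset.union_empty, Finset.card_empty]
    omega
  | insert ξ P hξ ih =>
    have hU : insert i S ∪ (insert ξ P).biUnion R = (insert i S ∪ P.biUnion R) ∪ R ξ := by
      rw [Finset.biUnion_insert, Finset.union_comm (R ξ), Finset.union_assoc]
    have hRU : R ξ ∩ (insert i S ∪ P.biUnion R) ⊆ S := by
      intro x hx
      simp only [Finset.mem_inter, Finset.mem_union, Finset.mem_insert, Finset.mem_biUnion] at hx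
      obtain ⟨hx, (rfl | hx') | ⟨η, hη, hx'⟩⟩ := hx
      · exact absurd hx (hi ξ)
      · exact hx'
      · have hne : ξ ≠ η := by rintro rfl; exact hξ hη
        exact absurd hx' (Finset.disjoint_left.1 (hdisj hne) hx)
    have h := columnRank_union_repair hS (hR ξ) Finset.subset_union_left hRU
    have hc := hcard ξ
    rw [hU, Finset.card_insert_of_notMem hξ, Nat.add_mul]
    omega

/-- A set of corank at least one can be enlarged to corank exactly one without
decreasing its nullity. -/
theorem exists_columnRank_add_one_eq [FiniteDimensional F V] [Fintype ι] {v : ι → V}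
    {I T : Finset ι} (hT : columnRank F v T < columnRank F v I) :
    ∃ W : Finset ι, columnRank F v W + 1 = columnRank F v I ∧
      T.card + columnRank F v W ≤ W.card + columnRank F v T := by
  classical
  obtain ⟨W, hW, hmax⟩ := Finset.exists_max_image
    (Finset.univ.filter fun W => columnRank F v W < columnRank F v I ∧
      T.card + columnRank F v W ≤ W.card + columnRank F v T) Finset.card
    ⟨T, by simpa using hT⟩
  simp only [Finset.mem_filter, Finset.mem_univ, true_and] at hW hmax
  refine ⟨W, ?_, hW.2⟩
  by_contra hne
  obtain ⟨i, -, hi⟩ := exists_notMem_span_of_columnRank_lt hW.1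
  have h1 := columnRank_insert_le (F := F) v i W
  have h2 := Finset.card_insert_of_notMem (notMem_of_notMem_span_image hi)
  have := hmax (insert i W) (by omega)
  omega

/-- Repair sets force a set of corank at least one and large nullity. -/
theorem exists_large_nullity [FiniteDimensional F V] [Fintype ι] {v : ι → V} {I : Finset ι}
    {k r t : ℕ} (hI : columnRank F v I = k + 1)
    (hloc : ∀ i ∈ I, ∃ R : Fin t → Finset ι, (∀ ξ, i ∉ R ξ) ∧
      (Pairwise fun ξ η => Disjoint (R ξ) (R η)) ∧ (∀ ξ, (R ξ).card ≤ r + 1) ∧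
      (∀ ξ, v i ∈ Submodule.span F (v '' ↑(R ξ)))) :
    ∃ (T : Finset ι) (ν : ℕ), columnRank F v T ≤ k ∧ columnRank F v T + ν ≤ T.card ∧
      k * t + 1 ≤ (r * t + 1) * (ν + 1) := by
  classical
  obtain ⟨S, hS, hmax⟩ := Finset.exists_max_image
    (Finset.univ.filter fun S => columnRank F v S ≤ k ∧ ∃ ν, columnRank F v S + ν ≤ S.card ∧
      columnRank F v S * t ≤ (r * t + 1) * ν) Finset.card
    ⟨∅, by simp [columnRank_empty]⟩
  simp only [Finset.mem_filter, Finset.mem_univ, true_and] at hS hmax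
  obtain ⟨hSk, ν, hSν, hinv⟩ := hS
  obtain ⟨i, hiI, hi⟩ := exists_notMem_span_of_columnRank_lt (by omega : columnRank F v S <
    columnRank F v I)
  obtain ⟨R, hiR, hdisj, hcard, hR⟩ := hloc i hiI
  have key := columnRank_insert_union_biUnion hi hiR hdisj hcard hR
  have hfull : k < columnRank F v (insert i S ∪ Finset.univ.biUnion R) := by
    by_contra! hle
    obtain ⟨h1, h2⟩ := key Finset.univ
    rw [Finset.card_univ, Fintype.card_fin] at h1 h2
    have hc := hmax _ ⟨hle, ν + t, by omega, by nlinarith⟩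
    have h3 := Finset.card_le_card
      (Finset.subset_union_left (s₁ := insert i S) (s₂ := Finset.univ.biUnion R))
    rw [Finset.card_insert_of_notMem (notMem_of_notMem_span_image hi)] at h3
    omega
  rcases hSk.eq_or_lt with hSk | hSk
  · exact ⟨S, ν, hSk.le, hSν, by rw [← hSk]; nlinarith⟩
  obtain ⟨P, hP, hPmax⟩ := Finset.exists_max_image
    (Finset.univ.filter fun P => columnRank F v (insert i S ∪ P.biUnion R) ≤ k) Finset.card
    ⟨∅, by
      have := (key ∅).1
      simp only [Finset.mem_filter, Finset.mem_univ, true_and]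
      rw [Finset.card_empty] at this
      omega⟩
  simp only [Finset.mem_filter, Finset.mem_univ, true_and] at hP hPmax
  obtain ⟨ξ, hξ⟩ : ∃ ξ, ξ ∉ P := by
    by_contra! hc
    rw [Finset.eq_univ_of_forall hc] at hP
    omega
  have hnext : k < columnRank F v (insert i S ∪ (insert ξ P).biUnion R) := by
    by_contra! hle
    have := hPmax _ hle
    rw [Finset.card_insert_of_notMem hξ] at this
    omega
  have h1 := (key (insert ξ P)).1
  rw [Finset.card_insert_of_notMem hξ] at h1
  have h2 := (key P).2
  refine ⟨_, ν + P.card, hP, by omega, ?_⟩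
  have hk : k ≤ columnRank F v S + (P.card + 1) * r := by omega
  have hkt := Nat.mul_le_mul_right t hk
  nlinarith

end ColumnRank

/-- Columns spanning a proper subspace avoid the support of some nonzero codeword. -/
theorem exists_ne_zero_hammingNorm_vecMul_add_card_le {F : Type*} [Field F] [DecidableEq F]
    {n k : ℕ} (G : Matrix (Fin k) (Fin n) F) (W : Finset (Fin n))
    (hW : columnRank F Gᵀ W < k) :
    ∃ x : Fin k → F, x ≠ 0 ∧ hammingNorm (x ᵥ* G) + W.card ≤ n := by
  have hlt : Submodule.span F (Gᵀ '' ↑W) < ⊤ := by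
    refine lt_top_iff_ne_top.2 fun h => ?_
    unfold columnRank at hW
    rw [h, finrank_top, Module.finrank_fin_fun] at hW
    exact lt_irrefl _ hW
  obtain ⟨f, hf, hle⟩ := Submodule.exists_le_ker_of_lt_top _ hlt
  have hdot : ∀ y, f y = (fun a => f (Pi.single a 1)) ⬝ᵥ y := by
    intro y
    conv_lhs => rw [pi_eq_sum_univ' y, map_sum]
    refine Finset.sum_congr rfl fun a _ => ?_
    rw [map_smul, smul_eq_mul, mul_comm]
  refine ⟨fun a => f (Pi.single a 1), fun h0 => hf (LinearMap.ext fun y => ?_), ?_⟩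
  · rw [hdot, h0, zero_dotProduct, LinearMap.zero_apply]
  · rw [hammingNorm, ← Finset.card_union_of_disjoint]
    · exact (Finset.card_le_univ _).trans_eq (Fintype.card_fin n)
    · refine Finset.disjoint_left.2 fun j hj hjW => (Finset.mem_filter.1 hj).2 ?_
      have := hle (Submodule.subset_span ⟨j, hjW, rfl⟩)
      rw [LinearMap.mem_ker, hdot] at this
      exact this

/-- Lower bound on the length of an `[n,k,d]_q` linear code with information
`(r,δ)_c`-locality: `n ≥ d + k - 1 + μ`, where
`μ = ⌈((k-1)(δ-1)+1)/((r-1)(δ-1)+1)⌉ - 1`. -/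
theorem stmt4 {F : Type*} [Field F] [Fintype F] [DecidableEq F] {n k d r δ : ℕ}
    (hr : 2 ≤ r) (hrk : r < k) (hδ : 2 ≤ δ)
    (G : Matrix (Fin k) (Fin n) F)
    (hfull : Module.finrank F (Submodule.span F (Set.range Gᵀ)) = k)
    (hd_le : ∀ x : Fin k → F, x ≠ 0 → d ≤ hammingNorm (x ᵥ* G))
    (hd_ex : ∃ x : Fin k → F, x ≠ 0 ∧ hammingNorm (x ᵥ* G) = d)
    (I : Finset (Fin n)) (hIcard : I.card = k)
    (hIrank : Module.finrank F (Submodule.span F (Gᵀ '' ↑I)) = k)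
    (hloc : ∀ i ∈ I, ∃ R : Fin (δ - 1) → Finset (Fin n),
      (∀ ξ, i ∉ R ξ) ∧
      (Pairwise fun ξ η => Disjoint (R ξ) (R η)) ∧
      (∀ ξ, (R ξ).card ≤ r) ∧
      (∀ ξ, Gᵀ i ∈ Submodule.span F (Gᵀ '' ↑(R ξ)))) :
    (d : ℤ) + (k : ℤ) - 1
        + (⌈(((k : ℚ) - 1) * ((δ : ℚ) - 1) + 1) / (((r : ℚ) - 1) * ((δ : ℚ) - 1) + 1)⌉ - 1)
      ≤ (n : ℤ) := by
  obtain ⟨K, rfl⟩ : ∃ K, k = K + 1 := ⟨k - 1, by omega⟩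
  obtain ⟨s, rfl⟩ : ∃ s, r = s + 1 := ⟨r - 1, by omega⟩
  obtain ⟨t, rfl⟩ : ∃ t, δ = t + 1 := ⟨δ - 1, by omega⟩
  obtain ⟨T, ν, hTK, hTν, hν⟩ := exists_large_nullity (v := Gᵀ) hIrank hloc
  have hI : columnRank F Gᵀ I = K + 1 := hIrank
  obtain ⟨W, hW, hTW⟩ := exists_columnRank_add_one_eq (F := F) (v := Gᵀ) (I := I) (T := T) (by omega)
  obtain ⟨x, hx, hxW⟩ := exists_ne_zero_hammingNorm_vecMul_add_card_le G W (by omega)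
  have hdx := hd_le x hx
  have hceil : ⌈((((K + 1 : ℕ) : ℚ) - 1) * (((t + 1 : ℕ) : ℚ) - 1) + 1) /
      ((((s + 1 : ℕ) : ℚ) - 1) * (((t + 1 : ℕ) : ℚ) - 1) + 1)⌉ ≤ (ν : ℤ) + 1 := by
    rw [Int.ceil_le]
    push_cast
    simp only [add_sub_cancel_right]
    rw [div_le_iff₀ (by positivity), mul_comm (ν + 1 : ℚ)]
    rw [Nat.add_sub_cancel] at hν
    exact_mod_cast hν
  omega
end

section
/- Let r ≥ 2, δ ≥ 2 be integers and let k = α((r−1)(δ−1)+1) + β with integers α ≥ 0 and 1 ≤ β ≤ (r−1)(δ−1)+1. Then μ = ⌈((k−1)(δ−1)+1)/((r−1)(δ−1)+1)⌉ − 1 satisfies μ ≤ α(δ−1) + (⌈(β−1)/(r−1)⌉ − 1)^+, where t^+ = max{t, 0}. -/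
/-- If `k = α((r-1)(δ-1)+1) + β` with `α ≥ 0`, `1 ≤ β ≤ (r-1)(δ-1)+1`, then
`μ = ⌈((k-1)(δ-1)+1)/((r-1)(δ-1)+1)⌉ - 1 ≤ α(δ-1) + (⌈(β-1)/(r-1)⌉ - 1)⁺`. -/
theorem stmt7 (r δ α β k : ℤ) (hr : 2 ≤ r) (hδ : 2 ≤ δ)
    (hα : 0 ≤ α) (hβ1 : 1 ≤ β) (hβ2 : β ≤ (r - 1) * (δ - 1) + 1)
    (hk : k = α * ((r - 1) * (δ - 1) + 1) + β) :
    ⌈(((k : ℚ) - 1) * ((δ : ℚ) - 1) + 1) / (((r : ℚ) - 1) * ((δ : ℚ) - 1) + 1)⌉ - 1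
      ≤ α * (δ - 1) + max (⌈((β : ℚ) - 1) / ((r : ℚ) - 1)⌉ - 1) 0 := by
  have ha : (1 : ℚ) ≤ (r : ℚ) - 1 := by
    have : (2 : ℚ) ≤ r := by exact_mod_cast hr
    linarith
  have hd : (1 : ℚ) ≤ (δ : ℚ) - 1 := by
    have : (2 : ℚ) ≤ δ := by exact_mod_cast hδ
    linarith
  have hn : (0 : ℚ) < ((r : ℚ) - 1) * ((δ : ℚ) - 1) + 1 := by nlinarith
  have hkq : (k : ℚ) = α * (((r : ℚ) - 1) * ((δ : ℚ) - 1) + 1) + β := by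
    rw [hk]; push_cast; ring
  have hc := Int.le_ceil (((β : ℚ) - 1) / ((r : ℚ) - 1))
  set c := ⌈((β : ℚ) - 1) / ((r : ℚ) - 1)⌉
  obtain ⟨M, hM⟩ : ∃ M, M = max (c - 1) 0 + 1 := ⟨_, rfl⟩
  have hM1 : (1 : ℚ) ≤ M := by
    have : 1 ≤ M := by omega
    exact_mod_cast this
  have hcM : (c : ℚ) ≤ M := by
    have : c ≤ M := by omega
    exact_mod_cast this
  have hβM : (β : ℚ) - 1 ≤ M * ((r : ℚ) - 1) :=
    (div_le_iff₀ (by linarith)).mp (hc.trans hcM)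
  have key : ⌈(((k : ℚ) - 1) * ((δ : ℚ) - 1) + 1) /
      (((r : ℚ) - 1) * ((δ : ℚ) - 1) + 1)⌉ ≤ α * (δ - 1) + M := by
    rw [Int.ceil_le, div_le_iff₀ hn, hkq]
    push_cast
    have := mul_le_mul_of_nonneg_right hβM (by linarith : (0 : ℚ) ≤ (δ : ℚ) - 1)
    linarith
  linarith
end

section
/- For all integers k, r, δ with 2 ≤ r < k and δ ≥ 2, one has μ ≤ (⌈k/r⌉ − 1)(δ−1), where μ = ⌈((k−1)(δ−1)+1)/((r−1)(δ−1)+1)⌉ − 1. (Consequently the minimum-distance bound d ≤ n − k + 1 − μ for codes with (r,δ)_c-locality is at least as strong as the bound d ≤ n − k + 1 − (⌈k/r⌉ − 1)(δ−1) for codes with locality (r,δ).) -/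
/-- For integers `2 ≤ r < k` and `δ ≥ 2`:
`μ = ⌈((k-1)(δ-1)+1)/((r-1)(δ-1)+1)⌉ - 1 ≤ (⌈k/r⌉ - 1)(δ-1)`. -/
theorem stmt8 (k r δ : ℤ) (hr : 2 ≤ r) (hrk : r < k) (hδ : 2 ≤ δ) :
    ⌈(((k : ℚ) - 1) * ((δ : ℚ) - 1) + 1) / (((r : ℚ) - 1) * ((δ : ℚ) - 1) + 1)⌉ - 1
      ≤ (⌈(k : ℚ) / (r : ℚ)⌉ - 1) * (δ - 1) := by
  have hr0 : (0 : ℚ) < r := by exact_mod_cast (by omega : 0 < r)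
  have hkr : (1 : ℚ) < (k : ℚ) / r := by
    rw [one_lt_div hr0]
    exact_mod_cast hrk
  have hk : (k : ℚ) / r ≤ ⌈(k : ℚ) / r⌉ := Int.le_ceil _
  generalize ⌈(k : ℚ) / r⌉ = m at hk ⊢
  have hm : (1 : ℤ) < m := by exact_mod_cast hkr.trans_le hk
  have hkm : k ≤ m * r := by exact_mod_cast (div_le_iff₀ hr0).1 hk
  have hden : 0 < (r - 1) * (δ - 1) + 1 := by nlinarith
  have key : (k - 1) * (δ - 1) + 1 ≤ ((m - 1) * (δ - 1) + 1) * ((r - 1) * (δ - 1) + 1) := by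
    have h₁ : 0 ≤ (m * r - k) * (δ - 1) := mul_nonneg (by omega) (by omega)
    have h₂ : 0 ≤ (m - 1) * (r - 1) * ((δ - 1) * (δ - 2)) :=
      mul_nonneg (mul_nonneg (by omega) (by omega)) (mul_nonneg (by omega) (by omega))
    linarith
  rw [sub_le_iff_le_add, Int.ceil_le, div_le_iff₀ (by exact_mod_cast hden)]
  exact_mod_cast key
end

section
/- For all integers k, r, δ with 2 ≤ r < k and δ ≥ 2, one has (1/r)(k + μ − ⌈(k+μ)/(r(δ−1)+1)⌉) < μ + 1, where μ = ⌈((k−1)(δ−1)+1)/((r−1)(δ−1)+1)⌉ − 1. -/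
/-- For integers `2 ≤ r < k` and `δ ≥ 2`, with
`μ = ⌈((k-1)(δ-1)+1)/((r-1)(δ-1)+1)⌉ - 1`:
`(1/r)(k + μ - ⌈(k+μ)/(r(δ-1)+1)⌉) < μ + 1`. -/
theorem stmt9 (k r δ : ℤ) (hr : 2 ≤ r) (hrk : r < k) (hδ : 2 ≤ δ)
    (μ : ℤ)
    (hμ : μ = ⌈(((k : ℚ) - 1) * ((δ : ℚ) - 1) + 1)
                / (((r : ℚ) - 1) * ((δ : ℚ) - 1) + 1)⌉ - 1) :
    (1 / (r : ℚ)) * ((k : ℚ) + (μ : ℚ)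
        - (⌈((k : ℚ) + (μ : ℚ)) / ((r : ℚ) * ((δ : ℚ) - 1) + 1)⌉ : ℤ))
      < (μ : ℚ) + 1 := by
  have hrQ : (2 : ℚ) ≤ r := by exact_mod_cast hr
  have hδQ : (2 : ℚ) ≤ δ := by exact_mod_cast hδ
  have hden : (0 : ℚ) < ((r : ℚ) - 1) * ((δ : ℚ) - 1) + 1 := by nlinarith
  have hden' : (0 : ℚ) < (r : ℚ) * ((δ : ℚ) - 1) + 1 := by nlinarith
  have hceil : (((k : ℚ) - 1) * ((δ : ℚ) - 1) + 1) / (((r : ℚ) - 1) * ((δ : ℚ) - 1) + 1)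
      ≤ (μ : ℚ) + 1 := by
    have h := Int.le_ceil ((((k : ℚ) - 1) * ((δ : ℚ) - 1) + 1)
      / (((r : ℚ) - 1) * ((δ : ℚ) - 1) + 1))
    rw [← sub_add_cancel (⌈_⌉ : ℤ) 1, ← hμ] at h
    exact_mod_cast h
  rw [div_le_iff₀ hden] at hceil
  have hexcess : ((k : ℚ) + μ - r * (μ + 1)) * ((δ : ℚ) - 1) ≤ μ := by linarith
  have hlt : k + μ - r * (μ + 1) < ⌈((k : ℚ) + (μ : ℚ)) / ((r : ℚ) * ((δ : ℚ) - 1) + 1)⌉ := by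
    rw [Int.lt_ceil, lt_div_iff₀ hden']
    push_cast
    have h := mul_le_mul_of_nonneg_left hexcess (by linarith : (0 : ℚ) ≤ r)
    linarith
  have hltQ : (k : ℚ) + μ - r * (μ + 1)
      < (⌈((k : ℚ) + (μ : ℚ)) / ((r : ℚ) * ((δ : ℚ) - 1) + 1)⌉ : ℤ) := by
    exact_mod_cast hlt
  rw [one_div, inv_mul_lt_iff₀ (by linarith)]
  linarith
end

section
/- Let k, r, δ be integers with 2 ≤ r < k and δ ≥ 2, set n = k(r(δ−1)+1) and μ = ⌈((k−1)(δ−1)+1)/((r−1)(δ−1)+1)⌉ − 1, and index {1,…,n} by points s^{(l)} and s^{(l)}_{ab} for 1 ≤ l ≤ k, 1 ≤ a ≤ δ−1, 1 ≤ b ≤ r. If q is a prime power with q ≥ 1 + C(n, k+μ), then there exists a k × n matrix G = (g_i) over F_q such that: (1) g_{s^{(l)}} + g_{s^{(l)}_{a1}} + ⋯ + g_{s^{(l)}_{ar}} = 0 for all 1 ≤ l ≤ k and 1 ≤ a ≤ δ−1; (2) the columns g_{s^{(1)}}, …, g_{s^{(k)}} are linearly independent (rank k); (3) every subset M of columns with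 |M| = k + μ has rank(M) = k. -/
open Matrix

open Module in
/-- A vector space over a field with `q` elements is not the union of at most `q` proper
subspaces. -/
theorem exists_forall_notMem_of_card_le {F V ι : Type*} [Field F] [Fintype F] [AddCommGroup V]
    [Module F V] [FiniteDimensional F V] [Fintype ι] (hι : Fintype.card ι ≤ Fintype.card F)
    (p : ι → Submodule F V) (hp : ∀ i, p i ≠ ⊤) : ∃ v, ∀ i, v ∉ p i := by
  classical
  by_contra! hcover
  have : Finite V := Module.finite_of_finite F
  have := Fintype.ofFinite V
  rcases isEmpty_or_nonempty ι with hE | ⟨⟨i₀⟩⟩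
  · obtain ⟨i, -⟩ := hcover 0
    exact hE.elim i
  set q := Fintype.card F
  obtain ⟨d, hd⟩ : ∃ d, finrank F V = d + 1 :=
    Nat.exists_eq_succ_of_ne_zero fun h => by
      have h1 := Submodule.finrank_lt (hp i₀)
      omega
  have hq : 1 < q := Fintype.one_lt_card
  have hcard (i : ι) : (Finset.univ.filter fun v => v ∈ p i ∧ v ≠ 0).card ≤ q ^ d - 1 := by
    have h1 : (Finset.univ.filter fun v => v ∈ p i ∧ v ≠ 0)
        = (Finset.univ.filter fun v => v ∈ p i).erase 0 := by
      ext v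
      simp [and_comm]
    rw [h1, Finset.card_erase_of_mem (by simp), ← Fintype.card_subtype]
    have h2 : Fintype.card (p i) = q ^ finrank F (p i) := Module.card_eq_pow_finrank
    have h3 := Submodule.finrank_lt (hp i)
    have h4 : Fintype.card {v // v ∈ p i} ≤ q ^ d := by
      rw [h2]
      exact Nat.pow_le_pow_right hq.le (by omega)
    omega
  have hunion : (Finset.univ.erase (0 : V))
      ⊆ Finset.univ.biUnion fun i => Finset.univ.filter fun v => v ∈ p i ∧ v ≠ 0 := by
    intro v hv
    obtain ⟨i, hi⟩ := hcover v
    simp only [Finset.mem_erase, Finset.mem_univ, and_true] at hv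
    simpa using ⟨⟨i, hi⟩, hv⟩
  have h1 := (Finset.card_le_card hunion).trans
    (Finset.card_biUnion_le_card_mul _ _ _ fun i _ => hcard i)
  rw [Finset.card_erase_of_mem (Finset.mem_univ _), Finset.card_univ, Finset.card_univ,
    Module.card_eq_pow_finrank (K := F) (V := V), hd] at h1
  have h2 := h1.trans (Nat.mul_le_mul_right _ hι)
  have h3 : 0 < q ^ d := by positivity
  change q ^ (d + 1) - 1 ≤ q * (q ^ d - 1) at h2
  rw [Nat.mul_sub, ← pow_succ', mul_one] at h2
  have h4 : q ≤ q ^ (d + 1) := Nat.le_self_pow (by omega) q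
  omega

open Module in
/-- Over a field with `q` elements, at most `q` subspaces of the same dimension have a common
complement, which can be chosen to contain a given subspace that is disjoint from all of them. -/
theorem exists_le_forall_isCompl {F V ι : Type*} [Field F] [Fintype F] [AddCommGroup V]
    [Module F V] [FiniteDimensional F V] [Fintype ι] (hι : Fintype.card ι ≤ Fintype.card F)
    {k : ℕ} (S : ι → Submodule F V) (hS : ∀ i, finrank F (S i) = k) (R : Submodule F V)
    (hR : ∀ i, Disjoint R (S i)) : ∃ K, R ≤ K ∧ ∀ i, IsCompl K (S i) := by
  have : Finite V := Module.finite_of_finite F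
  obtain ⟨K, hRK, hK⟩ := (Set.toFinite {K : Submodule F V | ∀ i, Disjoint K (S i)}).exists_le_maximal
    (show R ∈ _ from hR)
  refine ⟨K, hRK, fun i => ⟨hK.prop i, ?_⟩⟩
  rw [codisjoint_iff]
  by_contra hi
  have hdim (j : ι) : finrank F ↥(K ⊔ S j) = finrank F K + k := by
    have h := Submodule.finrank_sup_add_finrank_inf_eq K (S j)
    rwa [(hK.prop j).eq_bot, finrank_bot, add_zero, hS] at h
  obtain ⟨v, hv⟩ := exists_forall_notMem_of_card_le hι (fun j => K ⊔ S j) fun j hj => by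
    refine hi (Submodule.eq_top_of_finrank_eq ?_)
    rw [hdim, ← hdim j, hj, finrank_top]
  have hdisj (j : ι) : Disjoint (K ⊔ F ∙ v) (S j) := by
    have h1 : Disjoint (F ∙ v) (K ⊔ S j) := by
      rw [disjoint_comm]
      refine (Submodule.disjoint_span_singleton' ?_).2 (hv j)
      rintro rfl
      exact hv j (zero_mem _)
    rw [sup_comm]
    exact (hK.prop j).disjoint_sup_left_of_disjoint_sup_right h1
  exact hv i (Submodule.mem_sup_left (hK.le_of_ge hdisj le_sup_left
    (Submodule.mem_sup_right (Submodule.mem_span_singleton_self v))))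

open Module in
theorem exists_linearMap_forall_isCompl_ker {F V ι : Type*} [Field F] [Fintype F] [AddCommGroup V]
    [Module F V] [FiniteDimensional F V] [Fintype ι] [Nonempty ι]
    (hι : Fintype.card ι ≤ Fintype.card F)
    {k : ℕ} (S : ι → Submodule F V) (hS : ∀ i, finrank F (S i) = k) (R : Submodule F V)
    (hR : ∀ i, Disjoint R (S i)) :
    ∃ π : V →ₗ[F] (Fin k → F), Function.Surjective π ∧ R ≤ LinearMap.ker π ∧
      ∀ i, IsCompl (LinearMap.ker π) (S i) := by
  obtain ⟨K, hRK, hK⟩ := exists_le_forall_isCompl hι S hS R hR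
  obtain ⟨i⟩ := ‹Nonempty ι›
  let e : (V ⧸ K) ≃ₗ[F] (Fin k → F) := LinearEquiv.ofFinrankEq _ _ <| by
    rw [(K.quotientEquivOfIsCompl (S i) (hK i)).finrank_eq, hS, finrank_fin_fun]
  have hker : LinearMap.ker (e.toLinearMap ∘ₗ K.mkQ) = K := by
    rw [LinearEquiv.ker_comp, Submodule.ker_mkQ]
  refine ⟨e.toLinearMap ∘ₗ K.mkQ, ?_, by rwa [hker], by rwa [hker]⟩
  exact e.surjective.comp K.mkQ_surjective

open Module in
theorem Submodule.exists_le_finrank_eq {F V : Type*} [Field F] [AddCommGroup V] [Module F V]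
    [FiniteDimensional F V] (A : Submodule F V) {k : ℕ} (hk : k ≤ finrank F A) :
    ∃ S ≤ A, finrank F S = k := by
  obtain ⟨f, hf⟩ := exists_linearIndependent_of_le_finrank hk
  refine ⟨span F (Set.range fun i => (f i : V)), ?_, ?_⟩
  · rw [span_le]
    rintro _ ⟨i, rfl⟩
    exact (f i).2
  · simpa using! finrank_span_eq_card (hf.map' A.subtype A.ker_subtype)

open Module in
theorem Submodule.exists_le_finrank_eq_disjoint {F V : Type*} [Field F] [AddCommGroup V]
    [Module F V] [FiniteDimensional F V] (A R : Submodule F V) {k : ℕ}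
    (hk : finrank F ↥(R ⊓ A) + k ≤ finrank F A) :
    ∃ S ≤ A, finrank F S = k ∧ Disjoint R S := by
  obtain ⟨Q, hQ⟩ := (R.comap A.subtype).exists_isCompl
  have h1 := finrank_add_eq_of_isCompl hQ
  have h2 : finrank F (R.comap A.subtype) = finrank F ↥(R ⊓ A) := by
    rw [inf_comm, ← map_comap_subtype, finrank_map_subtype_eq]
  obtain ⟨S, hSQ, hS⟩ := Q.exists_le_finrank_eq (k := k) (by omega)
  refine ⟨S.map A.subtype, map_subtype_le _ _, by rw [finrank_map_subtype_eq, hS], ?_⟩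
  rw [disjoint_def]
  rintro _ hx ⟨y, hy, rfl⟩
  rw [disjoint_def.1 hQ.disjoint y hx (hSQ hy), map_zero]

/-- Within one group, a relation supported on `M` is determined by its coefficients on a set `B`
that is small compared to `M`. -/
theorem exists_card_le_of_group {F : Type*} [Field F] {D r : ℕ} (hr : 1 ≤ r)
    (M : Finset (Option (Fin D × Fin r))) :
    ∃ B : Finset (Fin D), (r * D + 1) * B.card ≤ D * M.card ∧
      ∀ c : Fin D → F, (∀ a b, some (a, b) ∉ M → c a = 0) → (none ∉ M → ∑ a, c a = 0) →
        (∀ a ∈ B, c a = 0) → c = 0 := by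
  classical
  set A : Finset (Fin D) := Finset.univ.filter fun a => ∀ b, some (a, b) ∈ M with hA
  have hAD : A.card ≤ D := by simpa using Finset.card_le_univ A
  have hzero (c : Fin D → F) (hc : ∀ a b, some (a, b) ∉ M → c a = 0) (a : Fin D) (ha : a ∉ A) :
      c a = 0 := by
    simp only [hA, Finset.mem_filter, Finset.mem_univ, true_and, not_forall] at ha
    obtain ⟨b, hb⟩ := ha
    exact hc a b hb
  have hsub : (A ×ˢ (Finset.univ : Finset (Fin r))).map Function.Embedding.some ⊆ M.erase none := by
    intro x hx
    simp only [Finset.mem_map, Finset.mem_product, Finset.mem_univ, and_true] at hx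
    obtain ⟨⟨a, b⟩, hab, rfl⟩ := hx
    simp only [hA, Finset.mem_filter, Finset.mem_univ, true_and] at hab
    simpa using hab b
  have hcard := Finset.card_le_card hsub
  rw [Finset.card_map, Finset.card_product, Finset.card_univ, Fintype.card_fin] at hcard
  by_cases hM : none ∈ M
  · refine ⟨A, ?_, fun c h1 _ h3 => funext fun a => ?_⟩
    · have := Finset.card_erase_add_one hM
      nlinarith
    · by_cases ha : a ∈ A
      exacts [h3 a ha, hzero c h1 a ha]
  · rw [Finset.erase_eq_of_notMem hM] at hcard
    rcases A.eq_empty_or_nonempty with hE | ⟨a₀, ha₀⟩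
    · refine ⟨∅, by simp, fun c h1 _ _ => funext fun a => hzero c h1 a (by simp [hE])⟩
    · refine ⟨A.erase a₀, ?_, fun c h1 h2 h3 => ?_⟩
      · have h := Finset.card_erase_add_one ha₀
        have h4 : D * (A.card * r) ≤ D * M.card := Nat.mul_le_mul_left _ hcard
        have h5 : D ≤ D * r := Nat.le_mul_of_pos_right _ hr
        rw [← h] at h4
        nlinarith
      · have h4 (a : Fin D) (ha : a ≠ a₀) : c a = 0 := by
          by_cases haA : a ∈ A
          exacts [h3 a (Finset.mem_erase.2 ⟨ha, haA⟩), hzero c h1 a haA]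
        have h5 := h2 hM
        rw [Finset.sum_eq_single a₀ (fun a _ ha => h4 a ha) (by simp)] at h5
        funext a
        by_cases ha : a = a₀
        exacts [ha ▸ h5, h4 a ha]

/-- The vector of coefficients of the combination of the group relations
`s⁽ˡ⁾ + ∑ b, s⁽ˡ⁾_{ab} = 0` with weights `c l a`. -/
def groupRelation (F : Type*) [Field F] (k D r : ℕ) :
    (Fin k → Fin D → F) →ₗ[F] (Fin k × Option (Fin D × Fin r) → F) where
  toFun c x := x.2.elim (∑ a, c x.1 a) fun ab => c x.1 ab.1
  map_add' c d := by
    ext ⟨l, _ | x⟩ <;> simp [Finset.sum_add_distrib]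
  map_smul' t c := by
    ext ⟨l, _ | x⟩ <;> simp [Finset.mul_sum]

@[simp]
theorem groupRelation_none {F : Type*} [Field F] {k D r : ℕ} (c : Fin k → Fin D → F) (l : Fin k) :
    groupRelation F k D r c (l, none) = ∑ a, c l a := rfl

@[simp]
theorem groupRelation_some {F : Type*} [Field F] {k D r : ℕ} (c : Fin k → Fin D → F) (l : Fin k)
    (a : Fin D) (b : Fin r) : groupRelation F k D r c (l, some (a, b)) = c l a := rfl

/-- The vectors supported on `M`. -/
def supportedOn (F : Type*) [Field F] {I : Type*} [Fintype I] [DecidableEq I] (M : Set I) :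
    Submodule F (I → F) :=
  Submodule.span F ((fun i => Pi.single i 1) '' M)

theorem apply_eq_zero_of_mem_supportedOn {F : Type*} [Field F] {I : Type*} [Fintype I]
    [DecidableEq I] {M : Set I} {x : I → F} (hx : x ∈ supportedOn F M) {i : I} (hi : i ∉ M) :
    x i = 0 := by
  have h : supportedOn F M ≤ LinearMap.ker (LinearMap.proj (R := F) (φ := fun _ : I => F) i) := by
    rw [supportedOn, Submodule.span_le]
    rintro _ ⟨j, hj, rfl⟩
    have hij : i ≠ j := fun h => hi (h ▸ hj)
    simp [hij]
  exact h hx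

theorem linearIndependent_pi_single (F : Type*) [Field F] (I : Type*) [Fintype I]
    [DecidableEq I] : LinearIndependent F (fun i : I => (Pi.single i 1 : I → F)) := by
  have h := (Pi.basisFun F I).linearIndependent
  convert h using 1
  ext i j
  simp

theorem finrank_supportedOn {F : Type*} [Field F] {I : Type*} [Fintype I]
    [DecidableEq I] (M : Finset I) : Module.finrank F (supportedOn F (M : Set I)) = M.card := by
  have h := finrank_span_eq_card
    ((linearIndependent_pi_single F I).comp ((↑) : M → I) Subtype.val_injective)
  have hM : Set.range ((↑) : M → I) = (M : Set I) := by
    ext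
    simp
  rwa [Fintype.card_coe, Set.range_comp, hM] at h

open Module in
theorem finrank_range_groupRelation_inf_le {F : Type*} [Field F] {k D r : ℕ} (hr : 1 ≤ r)
    (M : Finset (Fin k × Option (Fin D × Fin r))) :
    (r * D + 1) * finrank F ↥(LinearMap.range (groupRelation F k D r) ⊓ supportedOn F (M : Set _))
      ≤ D * M.card := by
  classical
  let N (l : Fin k) : Finset (Option (Fin D × Fin r)) := Finset.univ.filter fun x => (l, x) ∈ M
  choose B hB hBz using fun l => exists_card_le_of_group (F := F) hr (N l)
  have hNM : ∑ l, (N l).card = M.card := by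
    rw [← Finset.card_sigma]
    refine Finset.card_bij' (fun x _ => (x.1, x.2)) (fun x _ => ⟨x.1, x.2⟩) ?_ ?_ ?_ ?_ <;> simp [N]
  set W := (supportedOn F (M : Set _)).comap (groupRelation F k D r)
  have h1 : finrank F ↥(LinearMap.range (groupRelation F k D r) ⊓ supportedOn F (M : Set _))
      ≤ finrank F W := by
    rw [← Submodule.map_comap_eq]
    exact Submodule.finrank_map_le _ _
  let f : W →ₗ[F] ((Σ l, B l) → F) :=
    (LinearMap.pi fun x : Σ l, B l => LinearMap.proj x.2.1 ∘ₗ LinearMap.proj x.1) ∘ₗ W.subtype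
  have hf : Function.Injective f := by
    rw [← LinearMap.ker_eq_bot, LinearMap.ker_eq_bot']
    rintro ⟨c, hc⟩ hfc
    ext1
    funext l
    refine hBz l (c l) (fun a b hab => ?_) (fun hl => ?_) fun a ha => congrFun hfc ⟨l, a, ha⟩
    · exact apply_eq_zero_of_mem_supportedOn (i := (l, some (a, b))) hc (by simpa [N] using hab)
    · exact apply_eq_zero_of_mem_supportedOn (i := (l, none)) hc (by simpa [N] using hl)
  have h2 := LinearMap.finrank_le_finrank_of_injective hf
  rw [finrank_fintype_fun_eq_card, Fintype.card_sigma] at h2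
  simp only [Fintype.card_coe] at h2
  calc _ ≤ (r * D + 1) * ∑ l, (B l).card := Nat.mul_le_mul_left _ (h1.trans h2)
    _ ≤ D * M.card := by
      rw [← hNM, Finset.mul_sum, Finset.mul_sum]
      exact Finset.sum_le_sum fun l _ => hB l

theorem disjoint_range_groupRelation_supportedOn_none {F : Type*} [Field F] {k D r : ℕ}
    (hr : 1 ≤ r) : Disjoint (LinearMap.range (groupRelation F k D r))
      (supportedOn F (Set.range fun l => (l, none))) := by
  rw [Submodule.disjoint_def]
  rintro _ ⟨c, rfl⟩ hc
  suffices c = 0 by rw [this, map_zero]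
  funext l a
  exact apply_eq_zero_of_mem_supportedOn (i := (l, some (a, ⟨0, hr⟩))) hc (by simp)

theorem groupRelation_single {F : Type*} [Field F] {k D r : ℕ} (l : Fin k) (a : Fin D) :
    groupRelation F k D r (Pi.single l (Pi.single a 1)) =
      Pi.single (l, none) 1 + ∑ b, Pi.single (l, some (a, b)) 1 := by
  funext ⟨l', x⟩
  rcases x with _ | ⟨a', b'⟩
  · by_cases hl : l' = l
    · subst hl
      simp [Pi.single_apply]
    · simp [hl]
  · by_cases hl : l' = l
    · subst hl
      by_cases ha : a' = a
      · subst ha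
        simp [Pi.single_apply]
      · simp [ha]
    · simp [hl]

theorem le_of_mul_le_of_eq_ceil {k r δ μ : ℕ} (hk : 1 ≤ k) (hr : 1 ≤ r) (hδ : 1 ≤ δ)
    (hμ : (μ : ℤ) = ⌈(((k : ℚ) - 1) * ((δ : ℚ) - 1) + 1)
                      / (((r : ℚ) - 1) * ((δ : ℚ) - 1) + 1)⌉ - 1) {β : ℕ}
    (hβ : (r * (δ - 1) + 1) * β ≤ (δ - 1) * (k + μ)) : β ≤ μ := by
  obtain ⟨D, rfl⟩ : ∃ D, δ = D + 1 := ⟨δ - 1, by omega⟩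
  obtain ⟨s, rfl⟩ : ∃ s, r = s + 1 := ⟨r - 1, by omega⟩
  obtain ⟨m, rfl⟩ : ∃ m, k = m + 1 := ⟨k - 1, by omega⟩
  push_cast [add_sub_cancel_right] at hμ
  rw [Nat.add_sub_cancel] at hβ
  have h1 := Int.le_ceil (((m : ℚ) * D + 1) / (s * D + 1))
  rw [div_le_iff₀ (by positivity), show ⌈((m : ℚ) * D + 1) / (s * D + 1)⌉ = (μ : ℤ) + 1 by omega]
    at h1
  have h2 : m * D + 1 ≤ (μ + 1) * (s * D + 1) := by exact_mod_cast h1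
  by_contra! h
  have h3 : ((s + 1) * D + 1) * (μ + 1) ≤ D * (m + 1 + μ) :=
    (Nat.mul_le_mul_left _ h).trans hβ
  nlinarith

/-- Existence of the generator matrix of Proposition 1 / Theorem 2: columns are
indexed by points `s⁽ˡ⁾ = (l, none)` and `s⁽ˡ⁾_{ab} = (l, some (a,b))` for
`1 ≤ l ≤ k`, `1 ≤ a ≤ δ-1`, `1 ≤ b ≤ r` (so `n = k(r(δ-1)+1)` columns).  If the
field has at least `1 + C(n, k+μ)` elements, there is a `k × n` matrix `G` with
(1) each group `{s⁽ˡ⁾, s⁽ˡ⁾_{a1}, …, s⁽ˡ⁾_{ar}}` summing to zero,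
(2) the columns `s⁽¹⁾, …, s⁽ᵏ⁾` linearly independent, and
(3) every set of `k + μ` columns of rank `k`. -/
theorem stmt10 (k r δ : ℕ) (hr : 2 ≤ r) (hrk : r < k) (hδ : 2 ≤ δ)
    (n : ℕ) (hn : n = k * (r * (δ - 1) + 1))
    (μ : ℕ)
    (hμ : (μ : ℤ) = ⌈(((k : ℚ) - 1) * ((δ : ℚ) - 1) + 1)
                      / (((r : ℚ) - 1) * ((δ : ℚ) - 1) + 1)⌉ - 1)
    (F : Type*) [Field F] [Fintype F] [DecidableEq F]
    (hq : 1 + n.choose (k + μ) ≤ Fintype.card F) :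
    ∃ G : Matrix (Fin k) (Fin k × Option (Fin (δ - 1) × Fin r)) F,
      (∀ l : Fin k, ∀ a : Fin (δ - 1),
        Gᵀ (l, none) + ∑ b : Fin r, Gᵀ (l, some (a, b)) = 0) ∧
      LinearIndependent F (fun l : Fin k => Gᵀ (l, none)) ∧
      (∀ M : Finset (Fin k × Option (Fin (δ - 1) × Fin r)), M.card = k + μ →
        Module.finrank F (Submodule.span F (Gᵀ '' ↑M)) = k) := by
  classical
  have hr1 : 1 ≤ r := by omega
  set D := δ - 1
  set R := LinearMap.range (groupRelation F k D r)
  let ι := {M : Finset (Fin k × Option (Fin D × Fin r)) // M.card = k + μ}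
  have hS (M : ι) : ∃ S ≤ supportedOn F (M.1 : Set _), Module.finrank F S = k ∧ Disjoint R S := by
    refine Submodule.exists_le_finrank_eq_disjoint _ _ ?_
    have h := finrank_range_groupRelation_inf_le (F := F) hr1 M.1
    rw [M.2] at h
    have h' := le_of_mul_le_of_eq_ceil (by omega) hr1 (by omega) hμ h
    rw [finrank_supportedOn, M.2, add_comm]
    exact Nat.add_le_add_left h' k
  choose S hSM hSk hSR using hS
  have hι : Fintype.card (Option ι) ≤ Fintype.card F := by
    refine le_trans (le_of_eq ?_) hq
    rw [Fintype.card_option, Fintype.card_finset_len, hn]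
    simp [mul_comm, add_comm]
  have hS₀ : Module.finrank F (supportedOn F
      (Set.range fun l : Fin k => (l, (none : Option (Fin D × Fin r))))) = k := by
    have h := finrank_supportedOn (F := F)
      (Finset.univ.image fun l : Fin k => (l, (none : Option (Fin D × Fin r))))
    rw [Finset.card_image_of_injective _ (Prod.mk_left_injective none)] at h
    rwa [Finset.card_univ, Fintype.card_fin, Finset.coe_image, Finset.coe_univ,
      Set.image_univ] at h
  obtain ⟨π, hπ, hRπ, hcompl⟩ := exists_linearMap_forall_isCompl_ker hι
    (fun M => M.elim (supportedOn F (Set.range fun l => (l, none))) S)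
    (by rintro (_ | M); exacts [hS₀, hSk M]) R
    (by rintro (_ | M); exacts [disjoint_range_groupRelation_supportedOn_none hr1, hSR M])
  refine ⟨Matrix.of fun i j => π (Pi.single j 1) i, fun l a => ?_, ?_, fun M hM => ?_⟩
  · have h : π (groupRelation F k D r (Pi.single l (Pi.single a 1))) = 0 :=
      hRπ (LinearMap.mem_range_self _ _)
    rwa [groupRelation_single, map_add, map_sum] at h
  · refine ((linearIndependent_pi_single F _).comp _ (Prod.mk_left_injective none)).map (f := π) ?_
    rw [Set.range_comp]
    refine (hcompl none).disjoint.symm.mono_left (le_of_eq ?_)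
    rfl
  · have h1 : Submodule.span F ((Matrix.of fun i j => π (Pi.single j 1) i)ᵀ '' (M : Set _))
        = (supportedOn F (M : Set _)).map π := by
      rw [supportedOn, Submodule.map_span, Set.image_image]
      rfl
    have h2 : (supportedOn F (M : Set _)).map π = ⊤ := by
      rw [eq_top_iff, ← LinearMap.range_eq_top.2 hπ, ← Submodule.map_top,
        ← (hcompl (some ⟨M, hM⟩)).sup_eq_top, Submodule.map_sup]
      refine sup_le ?_ (Submodule.map_mono (hSM ⟨M, hM⟩))
      rintro _ ⟨x, hx, rfl⟩
      rw [show π x = 0 from hx]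
      exact zero_mem _
    rw [h1, h2, finrank_top, Module.finrank_fin_fun]
end

section
/- Let k, r, δ be integers with 2 ≤ r < k and δ ≥ 2, set n = k(r(δ−1)+1) and μ = ⌈((k−1)(δ−1)+1)/((r−1)(δ−1)+1)⌉ − 1. If q is a prime power with q ≥ 1 + C(n, k+μ), then there exists an [n,k,d]_q linear code with information (r,δ)_c-locality whose minimum distance satisfies d = n − k + 1 − μ, i.e., the bound n ≥ d + k − 1 + μ is attained with equality. -/
open Matrix

section GeneralPosition

variable {F V : Type*} [Field F] [Fintype F] [AddCommGroup V] [Module F V]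

open scoped Pointwise in
/-- A vector space over a finite field with `q` elements is not the union of fewer than `q`
proper subspaces. -/
theorem exists_forall_notMem_of_card_lt [FiniteDimensional F V] {σ : Type*} (s : Finset σ)
    (hs : s.card < Fintype.card F) (p : σ → Submodule F V) (hp : ∀ a ∈ s, p a ≠ ⊤) :
    ∃ v, ∀ a ∈ s, v ∉ p a := by
  by_contra! hcon
  have hcov : ⋃ a ∈ s, (fun _ => 0 : σ → V) a +ᵥ ((p a).toAddSubgroup : Set V) = Set.univ := by
    refine Set.eq_univ_of_forall fun v => ?_
    obtain ⟨a, ha, hv⟩ := hcon v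
    simp only [Set.mem_iUnion, zero_vadd]
    exact ⟨a, ha, hv⟩
  obtain ⟨a, ha, -, hle⟩ := AddSubgroup.exists_index_le_card_of_leftCoset_cover hcov
  have hidx : (p a).toAddSubgroup.index = Fintype.card F ^ Module.finrank F (V ⧸ p a) := by
    rw [← Nat.card_eq_fintype_card, ← Module.natCard_eq_pow_finrank]
    rfl
  have hpos : 0 < Module.finrank F (V ⧸ p a) := by
    have := Submodule.Quotient.nontrivial_iff.mpr (hp a ha)
    exact Module.finrank_pos
  have := Nat.le_self_pow hpos.ne' (Fintype.card F)
  omega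

/-- Given fewer than `q` surjections onto spaces of dimension `k`, some `k` vectors have
linearly independent images under each of them. -/
theorem exists_forall_linearIndependent_map [FiniteDimensional F V] {σ : Type*} (s : Finset σ)
    (hs : s.card < Fintype.card F) {U : σ → Type*} [∀ a, AddCommGroup (U a)]
    [∀ a, Module F (U a)] (φ : ∀ a, V →ₗ[F] U a)
    (hφ : ∀ a ∈ s, Function.Surjective (φ a)) {k : ℕ}
    (hk : ∀ a ∈ s, k ≤ Module.finrank F (U a)) :
    ∃ w : Fin k → V, ∀ a ∈ s, LinearIndependent F fun i => φ a (w i) := by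
  induction k with
  | zero => exact ⟨Fin.elim0, fun a _ => linearIndependent_empty_type⟩
  | succ k ih =>
    obtain ⟨w, hw⟩ := ih fun a ha => (Nat.le_succ k).trans (hk a ha)
    obtain ⟨v, hv⟩ := exists_forall_notMem_of_card_lt s hs
      (fun a => (Submodule.span F (Set.range fun i => φ a (w i))).comap (φ a)) (by
        intro a ha htop
        replace htop : Submodule.span F (Set.range fun i => φ a (w i)) = ⊤ :=
          eq_top_iff.mpr fun u _ => by
            obtain ⟨v, rfl⟩ := hφ a ha u
            exact Submodule.mem_comap.1 (htop ▸ Submodule.mem_top)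
        have h1 := finrank_range_le_card (R := F) fun i => φ a (w i)
        rw [Set.finrank, htop, finrank_top, Fintype.card_fin] at h1
        have := hk a ha
        omega)
    refine ⟨Fin.cons v w, fun a ha => ?_⟩
    have : (fun i => φ a ((Fin.cons v w : Fin (k + 1) → V) i))
        = Fin.cons (φ a v) fun i => φ a (w i) := by
      ext i
      refine Fin.cases ?_ (fun j => ?_) i <;> simp
    rw [this, linearIndependent_finCons]
    exact ⟨hw a ha, hv a ha⟩

end GeneralPosition

section Block

/-- A set of coordinates of a block (a centre `none` together with repair groups
`{some (ξ, j) | j}`) that contains no full repair group along with the centre, and at most one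
full repair group otherwise. -/
def BlockFree {X Y : Type*} (B : Set (Option (X × Y))) : Prop :=
  (none ∈ B → ∀ ξ, ∃ j, some (ξ, j) ∉ B) ∧
    ∀ ξ η, (∀ j, some (ξ, j) ∈ B) → (∀ j, some (η, j) ∈ B) → ξ = η

variable {X Y : Type*}

theorem BlockFree.mono {B C : Set (Option (X × Y))} (hC : BlockFree C) (h : B ⊆ C) :
    BlockFree B :=
  ⟨fun h0 ξ => (hC.1 (h h0) ξ).imp fun _ hj hB => hj (h hB),
    fun ξ η h1 h2 => hC.2 ξ η (fun j => h (h1 j)) fun j => h (h2 j)⟩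

theorem blockFree_singleton_none [Nonempty Y] : BlockFree ({none} : Set (Option (X × Y))) :=
  ⟨fun _ _ => ⟨Classical.arbitrary Y, by simp⟩,
    fun _ _ h => absurd (h (Classical.arbitrary Y)) (by simp)⟩

theorem BlockFree.exists_extension {F : Type*} [Field F] [Fintype Y] {B : Set (Option (X × Y))}
    (hB : BlockFree B) (u : Option (X × Y) → F) :
    ∃ w : Option (X × Y) → F, (∀ ξ, w none = ∑ j, w (some (ξ, j))) ∧ ∀ c ∈ B, w c = u c := by
  classical
  obtain ⟨a, ha0, ha⟩ : ∃ a : F, (none ∈ B → a = u none) ∧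
      ∀ ξ, (∀ j, some (ξ, j) ∈ B) → a = ∑ j, u (some (ξ, j)) := by
    by_cases hfull : ∃ ξ, ∀ j, some (ξ, j) ∈ B
    · obtain ⟨ξ, hξ⟩ := hfull
      refine ⟨∑ j, u (some (ξ, j)), fun h0 => ?_, fun η hη => by rw [hB.2 ξ η hξ hη]⟩
      obtain ⟨j, hj⟩ := hB.1 h0 ξ
      exact absurd (hξ j) hj
    · exact ⟨u none, fun _ => rfl, fun ξ hξ => absurd ⟨ξ, hξ⟩ hfull⟩
  have hgroup : ∀ ξ, ∃ v : Y → F, a = ∑ j, v j ∧ ∀ j, some (ξ, j) ∈ B → v j = u (some (ξ, j)) := by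
    intro ξ
    by_cases hξ : ∀ j, some (ξ, j) ∈ B
    · exact ⟨fun j => u (some (ξ, j)), ha ξ hξ, fun _ _ => rfl⟩
    · push Not at hξ
      obtain ⟨j₀, hj₀⟩ := hξ
      refine ⟨Function.update (fun j => u (some (ξ, j))) j₀
        (a - ∑ j ∈ Finset.univ \ {j₀}, u (some (ξ, j))), ?_, fun j hj => ?_⟩
      · rw [Finset.sum_update_of_mem (Finset.mem_univ j₀)]
        ring
      · rw [Function.update_of_ne]
        rintro rfl
        exact hj₀ hj
  choose v hv hvu using hgroup
  refine ⟨fun c => c.elim a fun p => v p.1 p.2, hv, ?_⟩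
  rintro (_ | ⟨ξ, j⟩) hc
  · exact ha0 hc
  · exact hvu ξ j hc

/-- Every set of coordinates of a block becomes free after deleting few of them. -/
theorem exists_blockFree_subset [Fintype X] [Fintype Y] [DecidableEq X] [DecidableEq Y]
    [Nonempty Y] (S : Finset (Option (X × Y))) :
    ∃ B ⊆ S, BlockFree (B : Set (Option (X × Y))) ∧
      (Fintype.card Y * Fintype.card X + 1) * (S \ B).card ≤ Fintype.card X * S.card := by
  let j₀ : Y := Classical.arbitrary Y
  let T : Finset X := Finset.univ.filter fun ξ => ∀ j, some (ξ, j) ∈ S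
  have hT : ∀ ξ, ξ ∈ T ↔ ∀ j, some (ξ, j) ∈ S := fun ξ => by simp [T]
  let P : Finset (Option (X × Y)) := (T ×ˢ Finset.univ).image some
  have hPS : P ⊆ S := by
    intro c hc
    simp only [P, Finset.mem_image, Finset.mem_product, Finset.mem_univ, and_true] at hc
    obtain ⟨⟨ξ, j⟩, hξ, rfl⟩ := hc
    exact (hT ξ).1 hξ j
  have hPcard : P.card = T.card * Fintype.card Y := by
    rw [Finset.card_image_of_injective _ (Option.some_injective _), Finset.card_product,
      Finset.card_univ]
  have hTX : T.card ≤ Fintype.card X := Finset.card_le_univ T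
  have hY : 1 ≤ Fintype.card Y := Fintype.card_pos
  have hdel : ∀ T' : Finset X, (S \ (S \ T'.image fun ξ => some (ξ, j₀))).card ≤ T'.card := by
    intro T'
    refine (Finset.card_le_card fun c hc => ?_).trans
      (Finset.card_image_le (f := fun ξ => some (ξ, j₀)))
    simp only [Finset.mem_sdiff] at hc
    tauto
  have hkeep : ∀ (T' : Finset X) ξ,
      (∀ j, some (ξ, j) ∈ ((S \ T'.image fun ξ => some (ξ, j₀) : Finset (Option (X × Y))) :
        Set (Option (X × Y)))) → ξ ∈ T ∧ ξ ∉ T' := by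
    intro T' ξ h
    refine ⟨(hT ξ).2 fun j => (Finset.mem_sdiff.1 (h j)).1, fun hξ => ?_⟩
    exact (Finset.mem_sdiff.1 (h j₀)).2 (Finset.mem_image_of_mem _ hξ)
  by_cases h0 : none ∈ S
  · refine ⟨S \ T.image fun ξ => some (ξ, j₀), Finset.sdiff_subset, ⟨fun _ ξ => ?_, ?_⟩, ?_⟩
    · by_contra! h
      exact (hkeep T ξ h).2 (hkeep T ξ h).1
    · intro ξ _ h
      exact absurd (hkeep T ξ h).1 (hkeep T ξ h).2
    · have hcard : T.card * Fintype.card Y + 1 ≤ S.card := by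
        rw [← hPcard, ← Finset.card_insert_of_notMem (a := none) (by simp [P])]
        exact Finset.card_le_card (Finset.insert_subset h0 hPS)
      have := hdel T
      calc _ ≤ (Fintype.card Y * Fintype.card X + 1) * T.card := by gcongr
        _ ≤ Fintype.card X * (T.card * Fintype.card Y + 1) := by nlinarith
        _ ≤ _ := by gcongr
  · rcases T.eq_empty_or_nonempty with hE | ⟨ξ₀, hξ₀⟩
    · refine ⟨S, subset_rfl, ⟨fun h => absurd h h0, fun ξ _ h => ?_⟩, by simp⟩
      have : ξ ∈ T := (hT ξ).2 h
      simp [hE] at this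
    · refine ⟨S \ (T.erase ξ₀).image fun ξ => some (ξ, j₀), Finset.sdiff_subset,
        ⟨fun h => absurd (Finset.mem_sdiff.1 h).1 h0, fun ξ η h1 h2 => ?_⟩, ?_⟩
      · have h1 := hkeep _ ξ h1
        have h2 := hkeep _ η h2
        simp only [Finset.mem_erase, not_and_or, not_not] at h1 h2
        rw [h1.2.resolve_right (not_not.2 h1.1), h2.2.resolve_right (not_not.2 h2.1)]
      · have hcard : T.card * Fintype.card Y ≤ S.card := hPcard ▸ Finset.card_le_card hPS
        have hd := hdel (T.erase ξ₀)
        rw [Finset.card_erase_of_mem hξ₀] at hd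
        obtain ⟨t, ht⟩ : ∃ t, T.card = t + 1 :=
          Nat.exists_eq_succ_of_ne_zero (Finset.card_ne_zero_of_mem hξ₀)
        rw [ht] at hd hcard hTX
        calc _ ≤ (Fintype.card Y * Fintype.card X + 1) * t := by gcongr; omega
          _ ≤ Fintype.card X * ((t + 1) * Fintype.card Y) := by nlinarith
          _ ≤ _ := by gcongr

end Block

section Code

variable {K X Y : Type*} [Fintype Y] [DecidableEq K] [DecidableEq X] [DecidableEq Y]

/-- The words on a family of blocks whose centre is the sum over each of its repair groups. -/
def repairCode (F K X Y : Type*) [Field F] [Fintype Y] :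
    Submodule F (K × Option (X × Y) → F) where
  carrier := {w | ∀ i ξ, w (i, none) = ∑ j, w (i, some (ξ, j))}
  add_mem' ha hb i ξ := by simp [ha i ξ, hb i ξ, Finset.sum_add_distrib]
  zero_mem' i ξ := by simp
  smul_mem' c w hw i ξ := by simp [hw i ξ, Finset.mul_sum]

/-- Restriction of words of `repairCode` to a set of coordinates. -/
def repairCodeRestrict (F : Type*) [Field F] (B : Finset (K × Option (X × Y))) :
    repairCode F K X Y →ₗ[F] (B → F) :=
  LinearMap.funLeft F F (Subtype.val : B → K × Option (X × Y)) ∘ₗ (repairCode F K X Y).subtype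

theorem repairCodeRestrict_surjective {F : Type*} [Field F] {B : Finset (K × Option (X × Y))}
    (hB : ∀ i, BlockFree {c | (i, c) ∈ B}) :
    Function.Surjective (repairCodeRestrict F B) := by
  intro u
  choose w hw hwu using fun i => (hB i).exists_extension
    fun c => if h : (i, c) ∈ B then u ⟨(i, c), h⟩ else 0
  refine ⟨⟨fun c => w c.1 c.2, hw⟩, ?_⟩
  ext ⟨⟨i, c⟩, hc⟩
  change w i c = _
  rw [hwu i c hc, dif_pos hc]

theorem exists_forall_blockFree_subset [Fintype K] [Fintype X] [Nonempty Y]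
    (S : Finset (K × Option (X × Y))) :
    ∃ B ⊆ S, (∀ i, BlockFree {c | (i, c) ∈ B}) ∧
      (Fintype.card Y * Fintype.card X + 1) * (S \ B).card ≤ Fintype.card X * S.card := by
  have hfib : ∀ A : Finset (K × Option (X × Y)),
      A.card = ∑ i, (Finset.univ.filter fun c => (i, c) ∈ A).card := by
    intro A
    conv_lhs => rw [← Finset.filter_univ_mem A]
    simp only [Finset.card_filter, Fintype.sum_prod_type]
  choose B hBS hB hcard using fun i =>
    exists_blockFree_subset (Finset.univ.filter fun c => (i, c) ∈ S)
  refine ⟨Finset.univ.filter fun c => c.2 ∈ B c.1, ?_, fun i => ?_, ?_⟩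
  · rintro ⟨i, c⟩ hc
    simpa using hBS i (by simpa using hc)
  · simpa using hB i
  · rw [hfib S, hfib (S \ _), Finset.mul_sum, Finset.mul_sum]
    refine Finset.sum_le_sum fun i _ => le_trans (Nat.mul_le_mul_left _ ?_) (hcard i)
    refine Finset.card_le_card fun c => ?_
    simp

/-- The vanishing of a word on some `κ` coordinates forces it on `κ + μ` coordinates. -/
theorem exists_vanishing_set (F : Type*) [Field F] {κ μ ρ D : ℕ} (hD : 0 < D)
    (h : μ * (ρ * D + 1) ≤ κ * D) :
    ∃ P Z : Finset (Fin (κ + 1) × Option (Fin D × Fin (ρ + 1))),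
      P.card ≤ κ ∧ Z.card = κ + μ ∧
        ∀ w ∈ repairCode F (Fin (κ + 1)) (Fin D) (Fin (ρ + 1)),
          (∀ c ∈ P, w c = 0) → ∀ c ∈ Z, w c = 0 := by
  have hle : μ * ρ ≤ κ := Nat.le_of_mul_le_mul_right (by nlinarith) hD
  obtain ⟨u, rfl⟩ := Nat.exists_eq_add_of_le hle
  obtain ⟨A, -, hA⟩ := Finset.exists_subset_card_eq
    (s := (Finset.univ : Finset (Fin (μ * ρ + u + 1)))) (n := u) (by simp; omega)
  obtain ⟨Γ, hΓA, hΓ⟩ := Finset.exists_subset_card_eq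
    (s := A ×ˢ (Finset.univ : Finset (Fin D))) (n := μ) (by
      rw [Finset.card_product, hA, Finset.card_univ, Fintype.card_fin]
      nlinarith)
  let C : Finset (Fin (μ * ρ + u + 1) × Option (Fin D × Fin (ρ + 1))) := A.image fun i => (i, none)
  have hC : C.card = u := by
    rw [Finset.card_image_of_injective _ fun i j hij => (Prod.ext_iff.1 hij).1, hA]
  refine ⟨C ∪ (Γ ×ˢ (Finset.univ : Finset (Fin ρ))).image
      fun p => (p.1.1, some (p.1.2, p.2.succ)),
    C ∪ (Γ ×ˢ (Finset.univ : Finset (Fin (ρ + 1)))).image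
      fun p => (p.1.1, some (p.1.2, p.2)), ?_, ?_, ?_⟩
  · refine (Finset.card_union_le _ _).trans ?_
    refine (Nat.add_le_add_left Finset.card_image_le _).trans ?_
    rw [hC, Finset.card_product, hΓ, Finset.card_univ, Fintype.card_fin, add_comm]
  · rw [Finset.card_union_of_disjoint, hC, Finset.card_image_of_injective, Finset.card_product,
      hΓ, Finset.card_univ, Fintype.card_fin]
    · ring
    · rintro ⟨⟨i, ξ⟩, j⟩ ⟨⟨i', ξ'⟩, j'⟩ hij
      simp only [Prod.mk.injEq, Option.some.injEq] at hij ⊢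
      tauto
    · rw [Finset.disjoint_left]
      intro c hc hc'
      simp only [C, Finset.mem_image] at hc hc'
      obtain ⟨i, -, rfl⟩ := hc
      obtain ⟨p, -, hp⟩ := hc'
      simp at hp
  · intro w hw hP c hc
    have hcentre : ∀ i ∈ A, w (i, none) = 0 := fun i hi =>
      hP _ (Finset.mem_union_left _ (Finset.mem_image_of_mem _ hi))
    have hsucc : ∀ i ξ, (i, ξ) ∈ Γ → ∀ j : Fin ρ, w (i, some (ξ, j.succ)) = 0 :=
      fun i ξ hi j => hP _ (Finset.mem_union_right _
        (Finset.mem_image.2 ⟨((i, ξ), j), by simpa using hi, rfl⟩))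
    rcases Finset.mem_union.1 hc with hc | hc
    · exact hP c (Finset.mem_union_left _ hc)
    · obtain ⟨⟨⟨i, ξ⟩, j⟩, hp, rfl⟩ := Finset.mem_image.1 hc
      have hi : (i, ξ) ∈ Γ := (Finset.mem_product.1 hp).1
      refine Fin.cases ?_ (hsucc i ξ hi) j
      have hsum := hw i ξ
      rw [hcentre i (Finset.mem_product.1 (hΓA hi)).1, Fin.sum_univ_succ,
        Finset.sum_eq_zero fun j _ => hsucc i ξ hi j, add_zero] at hsum
      exact hsum.symm

/-- A `(κ + 1)`-dimensional subcode of `repairCode` in general position: the centres form an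
information set, and `κ + μ` is the maximal number of zeros of a nonzero word. -/
theorem exists_subcode_repairCode {F : Type*} [Field F] [Fintype F] [DecidableEq F]
    {κ μ ρ D : ℕ} (hD : 0 < D) (hlo : κ * D + 1 ≤ (μ + 1) * (ρ * D + 1))
    (hup : μ * (ρ * D + 1) ≤ κ * D)
    (hq : (Fintype.card (Fin (κ + 1) × Option (Fin D × Fin (ρ + 1)))).choose (κ + 1 + μ)
      < Fintype.card F) :
    ∃ w : Fin (κ + 1) → repairCode F (Fin (κ + 1)) (Fin D) (Fin (ρ + 1)),
      (LinearIndependent F fun i j => (w i).1 (j, none)) ∧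
      (∀ x : Fin (κ + 1) → F, x ≠ 0 →
        (Finset.univ.filter fun c => (∑ i, x i • w i).1 c = 0).card ≤ κ + μ) ∧
      ∃ x : Fin (κ + 1) → F, x ≠ 0 ∧
        (Finset.univ.filter fun c => (∑ i, x i • w i).1 c = 0).card = κ + μ := by
  let ι := Fin (κ + 1) × Option (Fin D × Fin (ρ + 1))
  let centres : Finset ι := Finset.univ.image fun i => (i, none)
  have hcentres : centres.card = κ + 1 := by
    rw [Finset.card_image_of_injective _ fun i j hij => (Prod.ext_iff.1 hij).1]
    simp
  have hchoice : ∀ S : Finset ι, ∃ B : Finset ι, S.card = κ + 1 + μ →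
      B ⊆ S ∧ B.card = κ + 1 ∧ (∀ i, BlockFree {c | (i, c) ∈ B}) ∧
        (centres ⊆ S → B = centres) := by
    intro S
    by_cases hS : centres ⊆ S
    · refine ⟨centres, fun _ => ⟨hS, hcentres, fun i => ?_, fun _ => rfl⟩⟩
      convert blockFree_singleton_none (X := Fin D) (Y := Fin (ρ + 1)) using 1
      ext c
      simp [centres, eq_comm]
    · obtain ⟨B, hBS, hB, hcard⟩ := exists_forall_blockFree_subset S
      by_cases hScard : S.card = κ + 1 + μ
      · have hle : κ + 1 ≤ B.card := by
          have := Finset.card_sdiff_add_card_eq_card hBS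
          rw [Fintype.card_fin, Fintype.card_fin, hScard] at hcard
          have hlt : (S \ B).card < μ + 1 := by
            by_contra! hge
            have := Nat.mul_le_mul_left ((ρ + 1) * D + 1) hge
            nlinarith
          omega
        obtain ⟨C, hCB, hC⟩ := Finset.exists_subset_card_eq hle
        exact ⟨C, fun _ => ⟨hCB.trans hBS, hC, fun i => (hB i).mono fun c hc => hCB hc,
          fun h => absurd h hS⟩⟩
      · exact ⟨∅, fun h => absurd h hScard⟩
  choose B hB using hchoice
  obtain ⟨w, hw⟩ := exists_forall_linearIndependent_map (k := κ + 1)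
    (Finset.powersetCard (κ + 1 + μ) (Finset.univ : Finset ι))
    (by rwa [Finset.card_powersetCard, Finset.card_univ]) (fun S => repairCodeRestrict F (B S))
    (fun S hS => repairCodeRestrict_surjective (hB S (Finset.mem_powersetCard.1 hS).2).2.2.1)
    (fun S hS => by simp [(hB S (Finset.mem_powersetCard.1 hS).2).2.1])
  have hinj : ∀ S : Finset ι, S.card = κ + 1 + μ → ∀ x : Fin (κ + 1) → F,
      (∀ c ∈ B S, (∑ i, x i • w i).1 c = 0) → x = 0 := by
    intro S hS x hx
    have hli := hw S (Finset.mem_powersetCard.2 ⟨Finset.subset_univ S, hS⟩)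
    refine funext (Fintype.linearIndependent_iff.1 hli x ?_)
    simp_rw [← map_smul]
    rw [← map_sum]
    ext ⟨c, hc⟩
    exact hx c hc
  have hzeros : ∀ x : Fin (κ + 1) → F, x ≠ 0 →
      (Finset.univ.filter fun c => (∑ i, x i • w i).1 c = 0).card ≤ κ + μ := by
    intro x hx
    by_contra! hlt
    obtain ⟨S, hS, hScard⟩ := Finset.exists_subset_card_eq
      (show κ + 1 + μ ≤ (Finset.univ.filter fun c => (∑ i, x i • w i).1 c = 0).card by omega)
    exact hx (hinj S hScard x fun c hc =>
      (Finset.mem_filter.1 (hS ((hB S hScard).1 hc))).2)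
  refine ⟨w, ?_, hzeros, ?_⟩
  · have hι : κ + 1 + μ ≤ Fintype.card ι := by
      simp only [ι, Fintype.card_prod, Fintype.card_option, Fintype.card_fin]
      nlinarith
    obtain ⟨S, hS, hScard⟩ := Finset.exists_superset_card_eq (s := centres) (n := κ + 1 + μ)
      (by omega) hι
    rw [Fintype.linearIndependent_iff]
    intro x hx
    refine congrFun (hinj S hScard x fun c hc => ?_)
    rw [(hB S hScard).2.2.2 hS] at hc
    obtain ⟨j, -, rfl⟩ := Finset.mem_image.1 hc
    simpa using congrFun hx j
  · obtain ⟨P, Z, hP, hZ, hPZ⟩ := exists_vanishing_set F hD hup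
    have hker := LinearMap.ker_ne_bot_of_finrank_lt
      (f := repairCodeRestrict F P ∘ₗ Fintype.linearCombination F w) (by simp; omega)
    obtain ⟨x, hx, hx0⟩ := Submodule.exists_mem_ne_zero_of_ne_bot hker
    refine ⟨x, hx0, le_antisymm (hzeros x hx0) ?_⟩
    rw [← hZ]
    refine Finset.card_le_card fun c hc => ?_
    refine Finset.mem_filter.2 ⟨Finset.mem_univ c, hPZ _ (∑ i, x i • w i).2 (fun c hc => ?_) c hc⟩
    exact congrFun (LinearMap.mem_ker.1 hx) ⟨c, hc⟩

end Code

/-- Tightness of the bound for `n = k(r(δ-1)+1)`: over a field with at least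
`1 + C(n, k+μ)` elements there exists an `[n,k,d]` linear code (given by a
generator matrix `G` of rank `k`) with information `(r,δ)_c`-locality whose
minimum distance `d` satisfies `n = d + k - 1 + μ`, i.e. the bound
`n ≥ d + k - 1 + μ` is attained with equality. -/
theorem stmt11 (k r δ : ℕ) (hr : 2 ≤ r) (hrk : r < k) (hδ : 2 ≤ δ)
    (n : ℕ) (hn : n = k * (r * (δ - 1) + 1))
    (μ : ℕ)
    (hμ : (μ : ℤ) = ⌈(((k : ℚ) - 1) * ((δ : ℚ) - 1) + 1)
                      / (((r : ℚ) - 1) * ((δ : ℚ) - 1) + 1)⌉ - 1)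
    (F : Type*) [Field F] [Fintype F] [DecidableEq F]
    (hq : 1 + n.choose (k + μ) ≤ Fintype.card F) :
    ∃ (G : Matrix (Fin k) (Fin n) F) (d : ℕ),
      -- the generator matrix has full rank `k`
      Module.finrank F (Submodule.span F (Set.range Gᵀ)) = k ∧
      -- `d` is the minimum Hamming distance of the code
      (∀ x : Fin k → F, x ≠ 0 → d ≤ hammingNorm (x ᵥ* G)) ∧
      (∃ x : Fin k → F, x ≠ 0 ∧ hammingNorm (x ᵥ* G) = d) ∧
      -- information `(r,δ)_c`-locality
      (∃ I : Finset (Fin n), I.card = k ∧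
        Module.finrank F (Submodule.span F (Gᵀ '' ↑I)) = k ∧
        ∀ i ∈ I, ∃ R : Fin (δ - 1) → Finset (Fin n),
          (∀ ξ, i ∉ R ξ) ∧
          (Pairwise fun ξ η => Disjoint (R ξ) (R η)) ∧
          (∀ ξ, (R ξ).card ≤ r) ∧
          (∀ ξ, Gᵀ i ∈ Submodule.span F (Gᵀ '' ↑(R ξ)))) ∧
      -- the bound is met with equality: `d = n - k + 1 - μ`
      (n : ℤ) = (d : ℤ) + (k : ℤ) - 1 + (μ : ℤ) := by
  have hD : 0 < δ - 1 := by omega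
  obtain ⟨D, hDδ⟩ : ∃ D, D = δ - 1 := ⟨_, rfl⟩
  obtain ⟨κ, rfl⟩ : ∃ κ, k = κ + 1 := ⟨k - 1, by omega⟩
  obtain ⟨ρ, rfl⟩ : ∃ ρ, r = ρ + 1 := ⟨r - 1, by omega⟩
  have hδD : (δ : ℚ) - 1 = D := by
    rw [hDδ, Nat.cast_sub (by omega), Nat.cast_one]
  rw [← hDδ] at hn hD ⊢
  have hpos : (0 : ℚ) < ρ * D + 1 := by positivity
  have hμ' := hμ
  rw [hδD, eq_sub_iff_add_eq, eq_comm, Int.ceil_eq_iff] at hμ'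
  push_cast at hμ'
  simp only [add_sub_cancel_right] at hμ'
  rw [lt_div_iff₀ hpos, div_le_iff₀ hpos] at hμ'
  have hlo : κ * D + 1 ≤ (μ + 1) * (ρ * D + 1) := by exact_mod_cast hμ'.2
  have hup : μ * (ρ * D + 1) ≤ κ * D := Nat.lt_succ_iff.1 (by exact_mod_cast hμ'.1)
  have hcard : Fintype.card (Fin (κ + 1) × Option (Fin D × Fin (ρ + 1))) = n := by
    simp only [Fintype.card_prod, Fintype.card_option, Fintype.card_fin, hn]
    ring
  obtain ⟨w, hli, hzeros, x₀, hx₀, hzeros₀⟩ := exists_subcode_repairCode (F := F) hD hlo hup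
    (by rw [hcard]; omega)
  let e : Fin n ≃ Fin (κ + 1) × Option (Fin D × Fin (ρ + 1)) :=
    (Fintype.equivFinOfCardEq hcard).symm
  let G : Matrix (Fin (κ + 1)) (Fin n) F := Matrix.of fun i c => (w i).1 (e c)
  have hword : ∀ (x : Fin (κ + 1) → F) c, (x ᵥ* G) c = (∑ i, x i • w i).1 (e c) := by
    intro x c
    simp [Matrix.vecMul_eq_sum, G]
  have hnorm : ∀ x : Fin (κ + 1) → F, hammingNorm (x ᵥ* G)
      + (Finset.univ.filter fun c => (∑ i, x i • w i).1 c = 0).card = n := by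
    intro x
    have hmap : (Finset.univ.filter fun c => (x ᵥ* G) c = 0).card
        = (Finset.univ.filter fun c => (∑ i, x i • w i).1 c = 0).card :=
      Finset.card_equiv e fun c => by simp [hword]
    rw [← hmap, hammingNorm, add_comm, Finset.card_filter_add_card_filter_not, Finset.card_univ,
      Fintype.card_fin]
  let I : Finset (Fin n) := Finset.univ.image fun i => e.symm (i, none)
  have hspan : Module.finrank F (Submodule.span F (Gᵀ '' ↑I)) = κ + 1 := by
    have hcol : Gᵀ '' ↑I
        = Set.range (Matrix.of fun i j => (w i).1 (j, none) : Matrix _ (Fin (κ + 1)) F).col := by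
      rw [Finset.coe_image, Finset.coe_univ, Set.image_univ]
      refine (Set.range_comp (fun c i => G i c) _).symm.trans (congrArg Set.range ?_)
      ext j i
      simp [G, Matrix.col]
    rw [hcol, ← Matrix.rank_eq_finrank_span_cols]
    exact (LinearIndependent.rank_matrix hli).trans (Fintype.card_fin _)
  refine ⟨G, n - (κ + μ), ?_, ?_, ⟨x₀, hx₀, ?_⟩, ⟨I, ?_, hspan, ?_⟩, ?_⟩
  · refine le_antisymm ((Submodule.finrank_le _).trans (by simp)) ?_
    exact hspan.ge.trans <| Submodule.finrank_mono (Submodule.span_mono (Set.image_subset_range _ _))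
  · intro x hx
    have := hzeros x hx
    have := hnorm x
    omega
  · have := hnorm x₀
    omega
  · rw [Finset.card_image_of_injective _ fun i j hij => (Prod.ext_iff.1 (e.symm.injective hij)).1]
    simp
  · intro c hc
    obtain ⟨i, -, rfl⟩ := Finset.mem_image.1 hc
    refine ⟨fun ξ => Finset.univ.image fun j => e.symm (i, some (ξ, j)), ?_, ?_, ?_, ?_⟩
    · simp
    · intro ξ η hne
      rw [Finset.disjoint_left]
      intro c hc hc'
      obtain ⟨j, -, rfl⟩ := Finset.mem_image.1 hc
      obtain ⟨j', -, hj'⟩ := Finset.mem_image.1 hc'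
      simp only [EmbeddingLike.apply_eq_iff_eq, Prod.mk.injEq, Option.some.injEq, true_and] at hj'
      exact hne hj'.1.symm
    · intro ξ
      exact Finset.card_image_le.trans (by simp)
    · intro ξ
      have hsum : Gᵀ (e.symm (i, none)) = ∑ j, Gᵀ (e.symm (i, some (ξ, j))) := by
        ext l
        simpa [G] using (w l).2 i ξ
      rw [hsum]
      exact Submodule.sum_mem _ fun j _ => Submodule.subset_span
        (Set.mem_image_of_mem _ (by simp))
  · have := hnorm x₀
    omega
end

section
/- Let k, r, δ be integers with 2 ≤ r < k and δ ≥ 2, and let n ≥ k(r(δ−1)+1). Then there exists q_0 such that for every prime power q ≥ q_0 there exists an [n,k,d]_q linear code with information (r,δ)_c-locality whose minimum distance satisfies d = n − k + 1 − μ, where μ = ⌈((k−1)(δ−1)+1)/((r−1)(δ−1)+1)⌉ − 1. -/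
open Matrix

/-- Over a field with more elements than the family `W` has members, `k` vectors can be chosen
that stay independent modulo every `W i`, provided each `W i` has codimension at least `k`. -/
theorem exists_linearIndependent_mkQ_of_card_lt {F V ι : Type*} [Field F] [AddCommGroup V]
    [Module F V] [FiniteDimensional F V] [Fintype ι] (W : ι → Submodule F V)
    (hcard : Fintype.card ι < ENat.card F) (k : ℕ) (hW : ∀ i, k ≤ Module.finrank F (V ⧸ W i)) :
    ∃ x : Fin k → V, ∀ i, LinearIndependent F fun j => (W i).mkQ (x j) := by
  induction k with
  | zero => exact ⟨Fin.elim0, fun i => linearIndependent_empty_type⟩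
  | succ k ih =>
    obtain ⟨x, hx⟩ := ih fun i => (Nat.le_succ k).trans (hW i)
    let U : ι → Submodule F V := fun i =>
      (Submodule.span F (Set.range fun j => (W i).mkQ (x j))).comap (W i).mkQ
    have hU : ∀ i, U i ≠ ⊤ := by
      intro i hi
      have htop : Submodule.span F (Set.range fun j => (W i).mkQ (x j)) = ⊤ := by
        rw [eq_top_iff]
        intro y _
        obtain ⟨v, rfl⟩ := (W i).mkQ_surjective y
        have hv : v ∈ U i := hi ▸ Submodule.mem_top
        exact hv
      have h := finrank_span_eq_card (hx i)
      rw [htop, finrank_top, Fintype.card_fin] at h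
      have := hW i
      omega
    have hcover := Submodule.iUnion_ssubset_of_forall_ne_top_of_card_lt Finset.univ U hU
      (by simpa using hcard)
    obtain ⟨y, -, hy⟩ := Set.exists_of_ssubset hcover
    refine ⟨Fin.snoc x y, fun i => ?_⟩
    have hsnoc : (fun j => (W i).mkQ ((Fin.snoc x y : Fin (k + 1) → V) j)) =
        Fin.snoc (fun j => (W i).mkQ (x j)) ((W i).mkQ y) := by
      funext j
      refine Fin.lastCases ?_ (fun j => ?_) j <;> simp
    rw [hsnoc, linearIndependent_finSnoc]
    refine ⟨hx i, fun hmem => hy ?_⟩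
    simp only [Set.mem_iUnion]
    exact ⟨i, Finset.mem_univ i, hmem⟩

section Clusters

variable {F ι κ l : Type*} [Field F] {r : ℕ}

/-- The words whose entry at each cluster centre `p (c, none)` is the sum of the entries
`p (c, some (ξ, t))` over each line `ξ` of the cluster. -/
def clusterCode (F : Type*) [Field F] (p : κ × Option (l × Fin r) ↪ ι) : Submodule F (ι → F) where
  carrier := {v | ∀ c ξ, v (p (c, none)) = ∑ t, v (p (c, some (ξ, t)))}
  add_mem' := by
    intro v w hv hw c ξ
    simp [hv c ξ, hw c ξ, Finset.sum_add_distrib]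
  zero_mem' := by simp
  smul_mem' := by
    intro a v hv c ξ
    simp [hv c ξ, Finset.mul_sum]

/-- The words of the cluster code that vanish on `S`. -/
def vanishingOn (F : Type*) [Field F] (p : κ × Option (l × Fin r) ↪ ι) (S : Finset ι) :
    Submodule F (clusterCode F p) where
  carrier := {v | ∀ i ∈ S, v.1 i = 0}
  add_mem' := by
    intro v w hv hw i hi
    simp [hv i hi, hw i hi]
  zero_mem' := by simp
  smul_mem' := by
    intro a v hv i hi
    simp [hv i hi]

/-- A word can be prescribed freely on `T` when `T` misses a noncentral point of each line. -/
theorem exists_mem_clusterCode_eqOn (p : κ × Option (l × Fin r) ↪ ι) (T : Finset ι)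
    (hT : ∀ c ξ, ∃ t, p (c, some (ξ, t)) ∉ T) (w : ι → F) :
    ∃ v ∈ clusterCode F p, ∀ i ∈ T, v i = w i := by
  classical
  choose t₀ ht₀ using hT
  let f : κ × Option (l × Fin r) → F := fun
    | (c, none) => w (p (c, none))
    | (c, some (ξ, t)) =>
      if t = t₀ c ξ then
        w (p (c, none)) - ∑ s ∈ Finset.univ.erase (t₀ c ξ), w (p (c, some (ξ, s)))
      else w (p (c, some (ξ, t)))
  refine ⟨Function.extend p f w, fun c ξ => ?_, fun i hi => ?_⟩
  · simp only [p.injective.extend_apply]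
    rw [← Finset.add_sum_erase _ _ (Finset.mem_univ (t₀ c ξ))]
    have hsum : ∑ s ∈ Finset.univ.erase (t₀ c ξ), f (c, some (ξ, s)) =
        ∑ s ∈ Finset.univ.erase (t₀ c ξ), w (p (c, some (ξ, s))) :=
      Finset.sum_congr rfl fun s hs => by simp [f, Finset.ne_of_mem_erase hs]
    rw [hsum]
    simp [f]
  · by_cases h : ∃ j, p j = i
    · obtain ⟨⟨c, _ | ⟨ξ, t⟩⟩, rfl⟩ := h
      · rw [p.injective.extend_apply]
      · rw [p.injective.extend_apply]
        have : t ≠ t₀ c ξ := by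
          rintro rfl
          exact ht₀ c ξ hi
        simp [f, this]
    · rw [Function.extend_apply' _ _ _ h]

theorem card_le_finrank_quotient_vanishingOn [Finite ι] (p : κ × Option (l × Fin r) ↪ ι)
    (T : Finset ι) (hT : ∀ c ξ, ∃ t, p (c, some (ξ, t)) ∉ T) :
    T.card ≤ Module.finrank F (clusterCode F p ⧸ vanishingOn F p T) := by
  classical
  let φ : clusterCode F p →ₗ[F] (T → F) :=
    LinearMap.pi fun i => LinearMap.proj i.1 ∘ₗ (clusterCode F p).subtype
  have hφ : LinearMap.range φ = ⊤ := by
    rw [LinearMap.range_eq_top]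
    intro w
    obtain ⟨v, hv, hvw⟩ := exists_mem_clusterCode_eqOn p T hT
      fun i => if h : i ∈ T then w ⟨i, h⟩ else 0
    refine ⟨⟨v, hv⟩, funext fun i => ?_⟩
    simpa [φ] using hvw i.1 i.2
  have hker : LinearMap.ker φ = vanishingOn F p T := by
    ext v
    simp [φ, vanishingOn, funext_iff]
  have h := φ.quotKerEquivRange.finrank_eq
  rw [hφ, finrank_top, Module.finrank_pi, Fintype.card_coe, hker] at h
  exact h.ge

theorem finrank_quotient_anti {V : Type*} [AddCommGroup V] [Module F V] [FiniteDimensional F V]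
    {W W' : Submodule F V} (h : W ≤ W') :
    Module.finrank F (V ⧸ W') ≤ Module.finrank F (V ⧸ W) := by
  have := Submodule.finrank_mono h
  have := W.finrank_quotient_add_finrank
  have := W'.finrank_quotient_add_finrank
  omega

/-- A set of more than `K + μ` coordinates imposes more than `K` conditions on the cluster code. -/
theorem lt_finrank_quotient_vanishingOn [Finite ι] [Fintype κ] [Fintype l] {R : ℕ}
    (p : κ × Option (l × Fin (R + 1)) ↪ ι) {K μ : ℕ}
    (hμ : K * Fintype.card l < (μ + 1) * (R * Fintype.card l + 1)) (S : Finset ι)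
    (hS : K + μ < S.card) :
    K < Module.finrank F (clusterCode F p ⧸ vanishingOn F p S) := by
  classical
  let L : Finset (κ × l) := Finset.univ.filter fun a => ∀ t, p (a.1, some (a.2, t)) ∈ S
  let C : Finset κ := L.image Prod.fst
  let centres : Finset ι := C.image fun c => p (c, none)
  let lasts : Finset ι := L.image fun a => p (a.1, some (a.2, 0))
  let T : Finset ι := (S ∪ centres) \ lasts
  have hT : ∀ c ξ, ∃ t, p (c, some (ξ, t)) ∉ T := by
    intro c ξ
    by_cases h : (c, ξ) ∈ L
    · refine ⟨0, fun hmem => (Finset.mem_sdiff.1 hmem).2 ?_⟩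
      exact Finset.mem_image.2 ⟨(c, ξ), h, rfl⟩
    · have h' : ∃ t, p (c, some (ξ, t)) ∉ S := by simpa [L] using h
      obtain ⟨t, ht⟩ := h'
      refine ⟨t, fun hmem => ?_⟩
      simp [T, centres, ht] at hmem
  have hle : vanishingOn F p S ≤ vanishingOn F p T := by
    intro v hv i hi
    rcases Finset.mem_union.1 (Finset.mem_sdiff.1 hi).1 with hi | hi
    · exact hv i hi
    · obtain ⟨c, hc, rfl⟩ := Finset.mem_image.1 hi
      obtain ⟨⟨c, ξ⟩, ha, rfl⟩ := Finset.mem_image.1 hc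
      rw [v.2 c ξ]
      exact Finset.sum_eq_zero fun t _ => hv _ ((Finset.mem_filter.1 ha).2 t)
  refine lt_of_lt_of_le ?_
    ((card_le_finrank_quotient_vanishingOn p T hT).trans (finrank_quotient_anti hle))
  by_contra! hTK
  have hlasts : lasts.card ≤ L.card := Finset.card_image_le
  have hST : S.card ≤ T.card + L.card := by
    have h₁ : S.card ≤ (S ∪ centres).card := Finset.card_le_card Finset.subset_union_left
    have h₂ := Finset.le_card_sdiff lasts (S ∪ centres)
    have h₃ : T.card = ((S ∪ centres) \ lasts).card := rfl
    omega
  have hCL : L.card ≤ C.card * Fintype.card l := by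
    have hsub : L ⊆ C ×ˢ Finset.univ := fun a ha =>
      Finset.mem_product.2 ⟨Finset.mem_image_of_mem _ ha, Finset.mem_univ _⟩
    simpa [Finset.card_product] using Finset.card_le_card hsub
  have hCT : C.card + L.card * R ≤ T.card := by
    let g : κ ⊕ (κ × l) × Fin R → ι := Sum.elim (fun c => p (c, none))
      fun a => p (a.1.1, some (a.1.2, a.2.succ))
    have hg : Function.Injective g := by
      rintro (c | ⟨⟨c, ξ⟩, t⟩) (c' | ⟨⟨c', ξ'⟩, t'⟩) h <;> simp_all [g]
    have hsub : (C.disjSum (L ×ˢ (Finset.univ : Finset (Fin R)))).image g ⊆ T := by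
      intro i hi
      obtain ⟨a, ha, rfl⟩ := Finset.mem_image.1 hi
      rcases a with c | ⟨⟨c, ξ⟩, t⟩
      · have hc : c ∈ C := by simpa using ha
        refine Finset.mem_sdiff.2 ⟨Finset.mem_union_right _ (Finset.mem_image_of_mem _ hc), ?_⟩
        simp [g, lasts]
      · have hL : (c, ξ) ∈ L := by simpa using ha
        refine Finset.mem_sdiff.2
          ⟨Finset.mem_union_left _ ((Finset.mem_filter.1 hL).2 t.succ), ?_⟩
        simp [g, lasts, Fin.succ_ne_zero, eq_comm]
    have := Finset.card_le_card hsub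
    rwa [Finset.card_image_of_injective _ hg, Finset.card_disjSum, Finset.card_product,
      Finset.card_univ, Fintype.card_fin] at this
  have hL : μ + 1 ≤ L.card := by omega
  have h₁ : (μ + 1) * (R * Fintype.card l + 1) ≤ L.card * (R * Fintype.card l + 1) :=
    Nat.mul_le_mul_right _ hL
  have h₂ : (C.card + L.card * R) * Fintype.card l ≤ K * Fintype.card l :=
    Nat.mul_le_mul_right _ (hCT.trans hTK)
  nlinarith

/-- Some `K` coordinates determine `μ` further ones in the cluster code. -/
theorem exists_determined_coordinates [Fintype ι] [Fintype κ] [Fintype l] {R : ℕ}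
    (p : κ × Option (l × Fin (R + 1)) ↪ ι) {K μ : ℕ}
    (hμ : μ * (R * Fintype.card l + 1) ≤ K * Fintype.card l) (hl : 0 < Fintype.card l)
    (hK : K ≤ Fintype.card κ) (hι : K + μ ≤ Fintype.card ι) :
    ∃ U A : Finset ι, U.card = K ∧ A.card = μ ∧ Disjoint U A ∧
      ∀ v ∈ clusterCode F p, (∀ i ∈ U, v i = 0) → ∀ i ∈ A, v i = 0 := by
  classical
  obtain ⟨m, hm⟩ : ∃ m, m + μ * R = K := by
    refine ⟨K - μ * R, Nat.sub_add_cancel ?_⟩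
    refine Nat.le_of_mul_le_mul_right ?_ hl
    nlinarith
  have hmμ : μ ≤ m * Fintype.card l := by
    subst hm
    nlinarith
  obtain ⟨C, -, hC⟩ := Finset.exists_subset_card_eq
    (s := (Finset.univ : Finset κ)) (n := m) (by rw [Finset.card_univ]; omega)
  obtain ⟨L, hLC, hL⟩ := Finset.exists_subset_card_eq
    (s := C ×ˢ (Finset.univ : Finset l)) (n := μ)
    (by rw [Finset.card_product, hC, Finset.card_univ]; exact hmμ)
  let A : Finset ι := L.image fun a => p (a.1, some (a.2, 0))
  let U₀ : Finset ι := (C.image fun c => p (c, none)) ∪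
    (L ×ˢ (Finset.univ : Finset (Fin R))).image fun a => p (a.1.1, some (a.1.2, a.2.succ))
  have hA : A.card = μ := by
    rw [Finset.card_image_of_injective, hL]
    rintro ⟨c, ξ⟩ ⟨c', ξ'⟩ h
    simpa using h
  have hU₀ : U₀.card ≤ K := by
    refine (Finset.card_union_le _ _).trans ?_
    refine (Nat.add_le_add Finset.card_image_le Finset.card_image_le).trans ?_
    rw [Finset.card_product, hC, hL, Finset.card_univ, Fintype.card_fin, hm]
  have hsub : U₀ ⊆ Aᶜ := by
    intro i hi
    rw [Finset.mem_compl]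
    intro hiA
    obtain ⟨⟨c, ξ⟩, -, rfl⟩ := Finset.mem_image.1 hiA
    rcases Finset.mem_union.1 hi with h | h
    · simp at h
    · obtain ⟨⟨⟨c', ξ'⟩, t⟩, -, h⟩ := Finset.mem_image.1 h
      simp [Fin.succ_ne_zero] at h
  obtain ⟨U, hU₀U, hUA, hU⟩ := Finset.exists_subsuperset_card_eq hsub hU₀
    (by rw [Finset.card_compl, hA]; omega)
  refine ⟨U, A, hU, hA, ?_, fun v hv hvU i hi => ?_⟩
  · rw [← Finset.subset_compl_iff_disjoint_right]
    exact hUA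
  · obtain ⟨⟨c, ξ⟩, ha, rfl⟩ := Finset.mem_image.1 hi
    have hc : c ∈ C := (Finset.mem_product.1 (hLC ha)).1
    have h := hv c ξ
    rw [Fin.sum_univ_succ, hvU (p (c, none)) (hU₀U (Finset.mem_union_left _
        (Finset.mem_image_of_mem _ hc))), Finset.sum_eq_zero, add_zero] at h
    · exact h.symm
    · intro t _
      refine hvU _ (hU₀U (Finset.mem_union_right _ (Finset.mem_image.2
        ⟨((c, ξ), t), ?_, rfl⟩)))
      simpa using ha

end Clusters

theorem floor_bounds_of_ceil (K D R μ : ℕ)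
    (hμ : (μ : ℤ) = ⌈((K : ℚ) * D + 1) / ((R : ℚ) * D + 1)⌉ - 1) :
    μ * (R * D + 1) ≤ K * D ∧ K * D < (μ + 1) * (R * D + 1) := by
  have hpos : (0 : ℚ) < (R : ℚ) * D + 1 := by positivity
  have hceil : ⌈((K : ℚ) * D + 1) / ((R : ℚ) * D + 1)⌉ = (μ : ℤ) + 1 := by omega
  rw [Int.ceil_eq_iff, lt_div_iff₀ hpos, div_le_iff₀ hpos] at hceil
  obtain ⟨h₁, h₂⟩ := hceil
  push_cast at h₁ h₂
  rw [add_sub_cancel_right] at h₁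
  have h₁' : μ * (R * D + 1) < K * D + 1 := by exact_mod_cast h₁
  have h₂' : K * D + 1 ≤ (μ + 1) * (R * D + 1) := by exact_mod_cast h₂
  exact ⟨by omega, by omega⟩

/-- For `n ≥ k(r(δ-1)+1)` there exists `q₀` such that over every finite field
with at least `q₀` elements there exists an `[n,k,d]` linear code with
information `(r,δ)_c`-locality whose minimum distance `d` satisfies
`d = n - k + 1 - μ`, where `μ = ⌈((k-1)(δ-1)+1)/((r-1)(δ-1)+1)⌉ - 1`. -/
theorem stmt12 (k r δ : ℕ) (hr : 2 ≤ r) (hrk : r < k) (hδ : 2 ≤ δ)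
    (n : ℕ) (hn : k * (r * (δ - 1) + 1) ≤ n)
    (μ : ℕ)
    (hμ : (μ : ℤ) = ⌈(((k : ℚ) - 1) * ((δ : ℚ) - 1) + 1)
                      / (((r : ℚ) - 1) * ((δ : ℚ) - 1) + 1)⌉ - 1) :
    ∃ q₀ : ℕ, ∀ (F : Type) (_ : Field F) (_ : Fintype F) (_ : DecidableEq F),
      q₀ ≤ Fintype.card F →
      ∃ (G : Matrix (Fin k) (Fin n) F) (d : ℕ),
        -- the generator matrix has full rank `k`
        Module.finrank F (Submodule.span F (Set.range Gᵀ)) = k ∧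
        -- `d` is the minimum Hamming distance of the code
        (∀ x : Fin k → F, x ≠ 0 → d ≤ hammingNorm (x ᵥ* G)) ∧
        (∃ x : Fin k → F, x ≠ 0 ∧ hammingNorm (x ᵥ* G) = d) ∧
        -- information `(r,δ)_c`-locality
        (∃ I : Finset (Fin n), I.card = k ∧
          Module.finrank F (Submodule.span F (Gᵀ '' ↑I)) = k ∧
          ∀ i ∈ I, ∃ R : Fin (δ - 1) → Finset (Fin n),
            (∀ ξ, i ∉ R ξ) ∧
            (Pairwise fun ξ η => Disjoint (R ξ) (R η)) ∧
            (∀ ξ, (R ξ).card ≤ r) ∧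
            (∀ ξ, Gᵀ i ∈ Submodule.span F (Gᵀ '' ↑(R ξ)))) ∧
        -- `d = n - k + 1 - μ`
        (d : ℤ) = (n : ℤ) - (k : ℤ) + 1 - (μ : ℤ) := by
  obtain ⟨K, rfl⟩ : ∃ K, k = K + 1 := ⟨k - 1, by omega⟩
  obtain ⟨R, rfl⟩ : ∃ R, r = R + 1 := ⟨r - 1, by omega⟩
  obtain ⟨D, rfl⟩ : ∃ D, δ = D + 1 := ⟨δ - 1, by omega⟩
  simp only [Nat.add_sub_cancel] at hn ⊢
  obtain ⟨hμ₁, hμ₂⟩ := floor_bounds_of_ceil K D R μ (by simpa using hμ)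
  have hD : 0 < D := by omega
  have hKn : K + 1 + μ ≤ n := by
    have hμK : μ ≤ K * D := le_trans (Nat.le_mul_of_pos_right _ (Nat.succ_pos _)) hμ₁
    nlinarith [Nat.zero_le (K * D * R), Nat.zero_le (D * R)]
  obtain ⟨p⟩ : Nonempty (Fin (K + 1) × Option (Fin D × Fin (R + 1)) ↪ Fin n) := by
    refine Function.Embedding.nonempty_of_card_le ?_
    simpa [mul_comm D] using hn
  refine ⟨2 ^ n + 1, fun F _ _ _ hF => ?_⟩
  let good := {S : Finset (Fin n) //
    K + 1 ≤ Module.finrank F (clusterCode F p ⧸ vanishingOn F p S)}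
  have : Fintype good := Fintype.ofFinite _
  have hgood : Fintype.card good < ENat.card F := by
    have h : Fintype.card good ≤ Fintype.card (Finset (Fin n)) :=
      Fintype.card_le_of_injective _ Subtype.val_injective
    rw [Fintype.card_finset, Fintype.card_fin] at h
    rw [ENat.card_eq_coe_fintype_card]
    exact_mod_cast h.trans_lt hF
  obtain ⟨x, hx⟩ := exists_linearIndependent_mkQ_of_card_lt
    (fun S : good => vanishingOn F p S.1) hgood (K + 1) fun S => S.2
  let G : Matrix (Fin (K + 1)) (Fin n) F := Matrix.of fun i => (x i).1
  have hG : ∀ c, c ᵥ* G = (∑ i, c i • x i : clusterCode F p).1 := by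
    intro c
    funext j
    simp [G, Matrix.vecMul, dotProduct]
  have hvan : ∀ S : Finset (Fin n),
      K + 1 ≤ Module.finrank F (clusterCode F p ⧸ vanishingOn F p S) →
      ∀ c, (∀ j ∈ S, (c ᵥ* G) j = 0) → c = 0 := by
    intro S hS c hc
    have hmem : (∑ i, c i • x i) ∈ vanishingOn F p S := fun j hj => by
      rw [← hG]
      exact hc j hj
    have h := (Submodule.Quotient.mk_eq_zero _).2 hmem
    rw [← Submodule.mkQ_apply, map_sum] at h
    simp only [map_smul] at h
    exact funext (Fintype.linearIndependent_iff.1 (hx ⟨S, hS⟩) c h)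
  have hnorm : ∀ c, hammingNorm (c ᵥ* G) =
      n - (Finset.univ.filter fun j => (c ᵥ* G) j = 0).card := by
    intro c
    have h := Finset.card_filter_add_card_filter_not (s := (Finset.univ : Finset (Fin n)))
      fun j => (c ᵥ* G) j = 0
    rw [Finset.card_univ, Fintype.card_fin] at h
    have h' : hammingNorm (c ᵥ* G) =
      (Finset.univ.filter fun j => ¬ (c ᵥ* G) j = 0).card := rfl
    omega
  have hlow : ∀ c, c ≠ 0 → n - (K + μ) ≤ hammingNorm (c ᵥ* G) := by
    intro c hc
    rw [hnorm]
    refine Nat.sub_le_sub_left ?_ n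
    by_contra! hcard
    refine hc (hvan _ (lt_finrank_quotient_vanishingOn p ?_ _ hcard) c ?_)
    · simpa using hμ₂
    · simp
  let I : Finset (Fin n) := Finset.univ.image fun c => p (c, none)
  have hIcard : I.card = K + 1 := by
    rw [Finset.card_image_of_injective, Finset.card_univ, Fintype.card_fin]
    intro c c' h
    simpa using h
  have hIrank : Module.finrank F (Submodule.span F (Gᵀ '' ↑I)) = K + 1 := by
    let M : Matrix (Fin (K + 1)) (Fin (K + 1)) F := G.submatrix id fun c => p (c, none)
    have hM : IsUnit M := by
      rw [← Matrix.vecMul_injective_iff_isUnit]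
      rw [← Matrix.coe_vecMulLinear, injective_iff_map_eq_zero]
      intro c hc
      refine hvan I ?_ c fun j hj => ?_
      · exact hIcard.ge.trans
          (card_le_finrank_quotient_vanishingOn p I fun c ξ => ⟨0, by simp [I]⟩)
      · obtain ⟨a, -, rfl⟩ := Finset.mem_image.1 hj
        exact congrFun hc a
    have hli := Matrix.linearIndependent_cols_iff_isUnit.2 hM
    have hrange : Gᵀ '' ↑I = Set.range M.col := by
      rw [Finset.coe_image, Finset.coe_univ, Set.image_univ]
      exact (Set.range_comp _ _).symm
    rw [hrange, finrank_span_eq_card hli, Fintype.card_fin]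
  refine ⟨G, n - (K + μ), ?_, hlow, ?_, ⟨I, hIcard, hIrank, fun i hi => ?_⟩, ?_⟩
  · refine le_antisymm ?_ ?_
    · simpa using Submodule.finrank_le (Submodule.span F (Set.range Gᵀ))
    · exact hIrank.ge.trans
        (Submodule.finrank_mono (Submodule.span_mono (Set.image_subset_range _ _)))
  · obtain ⟨U, A, hU, hA, hUA, hdet⟩ := exists_determined_coordinates (F := F) p (K := K) (μ := μ)
      (by simpa using hμ₁) (by simpa using hD) (by simp) (by rw [Fintype.card_fin]; omega)
    let φ : (Fin (K + 1) → F) →ₗ[F] (U → F) :=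
      LinearMap.pi fun j => LinearMap.proj j.1 ∘ₗ G.vecMulLinear
    obtain ⟨c, hcφ, hc⟩ := (Submodule.ne_bot_iff _).1
      (LinearMap.ker_ne_bot_of_finrank_lt (f := φ) (by simp [hU]))
    have hcU : ∀ j ∈ U, (c ᵥ* G) j = 0 := fun j hj =>
      congrFun (LinearMap.mem_ker.1 hcφ) ⟨j, hj⟩
    refine ⟨c, hc, le_antisymm ?_ (hlow c hc)⟩
    have hcA := hdet (c ᵥ* G) (by rw [hG]; exact Subtype.property _) hcU
    have hUAcard : (U ∪ A).card = K + μ := by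
      rw [Finset.card_union_of_disjoint hUA, hU, hA]
    rw [hnorm]
    refine Nat.sub_le_sub_left (hUAcard.ge.trans (Finset.card_le_card fun j hj => ?_)) n
    simp only [Finset.mem_filter, Finset.mem_univ, true_and]
    exact (Finset.mem_union.1 hj).elim (hcU j) (hcA j)
  · obtain ⟨c, -, rfl⟩ := Finset.mem_image.1 hi
    refine ⟨fun ξ => Finset.univ.image fun t => p (c, some (ξ, t)), fun ξ => by simp,
      fun ξ η hξη => ?_, fun ξ => Finset.card_image_le.trans (by simp), fun ξ => ?_⟩
    · refine Finset.disjoint_left.2 ?_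
      intro j hj hj'
      obtain ⟨t, -, rfl⟩ := Finset.mem_image.1 hj
      obtain ⟨s, -, h⟩ := Finset.mem_image.1 hj'
      simp at h
      exact hξη h.1.symm
    · have h : Gᵀ (p (c, none)) = ∑ t, Gᵀ (p (c, some (ξ, t))) := by
        funext i
        rw [Finset.sum_apply]
        exact (x i).2 c ξ
      rw [h]
      refine Submodule.sum_mem _ fun t _ => Submodule.subset_span (Set.mem_image_of_mem _ ?_)
      simp
  · omega
end

section
/- The binary linear code of length 6 generated by the 3 × 6 matrix G over F_2 with rows (1,0,0,1,1,1), (0,1,0,1,0,1), (0,0,1,0,1,1) has dimension 3 and minimum Hamming distance 3, and every coordinate i ∈ {1,…,6} has (r,δ)_c-locality with r = 2 and δ = 3: there exist two pairwise disjoint sets R_1, R_2 ⊆ {1,…,6}\{i}, each of size at most 2, with the i-th column of G lying in the F_2-span of the columns indexed by each R_ξ. In particular this code attains the bound n ≥ d + k − 1 + μ with equality, where μ = ⌈((k−1)(δ−1)+1)/((r−1)(δ−1)+1)⌉ − 1 = 1. -/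
open Matrix

/-- The `i`-th column lies in the span of the columns indexed by `s` as soon as it is their sum. -/
theorem transpose_mem_span_of_eq_sum {m n R : Type*} [Semiring R] (G : Matrix m n R) (i : n)
    (s : Finset n) (h : Gᵀ i = ∑ j ∈ s, Gᵀ j) : Gᵀ i ∈ Submodule.span R (Gᵀ '' ↑s) :=
  h ▸ Submodule.sum_mem _ fun _ hj => Submodule.subset_span (Set.mem_image_of_mem _ hj)

/-- The two repair sets of each coordinate of the binary `[6,3,3]` code. -/
def repairSet : Fin 6 → Fin 2 → Finset (Fin 6) :=
  ![![{1, 3}, {2, 4}], ![{0, 3}, {4, 5}], ![{0, 4}, {3, 5}],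
    ![{0, 1}, {2, 5}], ![{0, 2}, {1, 5}], ![{1, 4}, {2, 3}]]

/-- The binary `[6,3,3]` code of Example 2: it has dimension 3, minimum
Hamming distance 3, every coordinate has `(r = 2, δ = 3)_c`-locality, and it
attains the bound `n ≥ d + k - 1 + μ` with equality, where
`μ = ⌈((k-1)(δ-1)+1)/((r-1)(δ-1)+1)⌉ - 1 = 1`. -/
theorem stmt14 :
    ∀ G : Matrix (Fin 3) (Fin 6) (ZMod 2),
      G = !![1,0,0,1,1,1; 0,1,0,1,0,1; 0,0,1,0,1,1] →
      -- the code has dimension 3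
      Module.finrank (ZMod 2) (Submodule.span (ZMod 2) (Set.range G)) = 3 ∧
      -- the minimum Hamming distance is 3
      (∀ x : Fin 3 → ZMod 2, x ≠ 0 → 3 ≤ hammingNorm (x ᵥ* G)) ∧
      (∃ x : Fin 3 → ZMod 2, x ≠ 0 ∧ hammingNorm (x ᵥ* G) = 3) ∧
      -- every coordinate has `(2,3)_c`-locality: two pairwise disjoint
      -- repair sets of size at most 2
      (∀ i : Fin 6, ∃ R : Fin 2 → Finset (Fin 6),
        (∀ ξ, i ∉ R ξ) ∧
        (Pairwise fun ξ η => Disjoint (R ξ) (R η)) ∧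
        (∀ ξ, (R ξ).card ≤ 2) ∧
        (∀ ξ, Gᵀ i ∈ Submodule.span (ZMod 2) (Gᵀ '' ↑(R ξ)))) ∧
      -- with `k = 3`, `r = 2`, `δ = 3`: `μ = 1` and `n = d + k - 1 + μ`
      (⌈(((3 : ℚ) - 1) * ((3 : ℚ) - 1) + 1) / (((2 : ℚ) - 1) * ((3 : ℚ) - 1) + 1)⌉
          - 1 = (1 : ℤ)) ∧
      (6 : ℤ) = 3 + 3 - 1 + 1 := by
  rintro G rfl
  refine ⟨?_, by decide +revert, ⟨![1, 0, 1], by decide, by decide⟩, fun i => ⟨repairSet i, ?_⟩, ?_,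
    by norm_num⟩
  · refine (finrank_span_eq_card ?_).trans (Fintype.card_fin 3)
    refine Fintype.linearIndependent_iff.2 ?_
    decide
  · refine ⟨by decide +revert, ?_, by decide +revert, fun ξ => ?_⟩
    · unfold Pairwise
      decide +revert
    · apply transpose_mem_span_of_eq_sum
      decide +revert
  · rw [sub_eq_iff_eq_add, Int.ceil_eq_iff]
    norm_num
end

section
/- Let r ≥ 2 and k = r^2 − r + 1. Then μ_k ≤ 2(r − ⌊√(r−1)⌋) − 1, where μ_k = max{x ∈ {0,…,2r+1} : f(x) − x ≤ k−1} and f(x) = x(r+1) − x^2/4 for even x, f(x) = x(r+1) − (x^2−1)/4 for odd x. Consequently, with δ = 3 and n = (r+1)^2, the quantity (n − k + 1 − μ_k) − (n − k + 1 − (⌈k/r⌉ − 1)(δ−1)) is at least 2(⌊√(r−1)⌋ − 1) + 1. -/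
/-- For `r ≥ 2` and `k = r² - r + 1`: `μ_k ≤ 2(r - ⌊√(r-1)⌋) - 1`, and with
`δ = 3`, `n = (r+1)²`, the minimum-distance gap
`(n - k + 1 - μ_k) - (n - k + 1 - (⌈k/r⌉ - 1)(δ-1))` is at least
`2(⌊√(r-1)⌋ - 1) + 1`. -/
theorem stmt18 (r k : ℕ) (hr : 2 ≤ r) (hk : k = r ^ 2 - r + 1)
    (f : ℕ → ℕ)
    (hf : ∀ x, f x = if Even x then x * (r + 1) - x ^ 2 / 4
                     else x * (r + 1) - (x ^ 2 - 1) / 4)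
    (μk : ℕ) (hμk : μk = Nat.findGreatest (fun x => f x - x ≤ k - 1) (2 * r + 1))
    (n δ : ℕ) (hn : n = (r + 1) ^ 2) (hδ : δ = 3) :
    (μk : ℤ) ≤ 2 * ((r : ℤ) - (Nat.sqrt (r - 1) : ℤ)) - 1 ∧
    2 * ((Nat.sqrt (r - 1) : ℤ) - 1) + 1 ≤
      ((n : ℤ) - (k : ℤ) + 1 - (μk : ℤ))
        - ((n : ℤ) - (k : ℤ) + 1 - (⌈(k : ℚ) / (r : ℚ)⌉ - 1) * ((δ : ℤ) - 1)) := by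
  obtain ⟨q, rfl⟩ : ∃ q, r = q + 1 := ⟨r - 1, by omega⟩
  obtain rfl : k = q * (q + 1) + 1 := by
    have : (q + 1) ^ 2 = q * (q + 1) + (q + 1) := by ring
    omega
  subst hn hδ
  simp only [Nat.add_sub_cancel] at hμk ⊢
  have hμ_le : μk ≤ 2 * (q + 1) + 1 := hμk ▸ Nat.findGreatest_le _
  have hμ_spec : f μk - μk ≤ q * (q + 1) := by
    have h0 : f 0 - 0 ≤ q * (q + 1) := by simp [hf]
    rw [hμk]
    exact Nat.findGreatest_spec (P := fun x => f x - x ≤ q * (q + 1)) (Nat.zero_le _) h0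
  have hs : Nat.sqrt q * Nat.sqrt q ≤ q := Nat.sqrt_le q
  clear hμk
  generalize Nat.sqrt q = s at *
  have hμ : (μk : ℤ) ≤ 2 * (((q + 1 : ℕ) : ℤ) - (s : ℤ)) - 1 := by
    rw [hf] at hμ_spec
    push_cast
    obtain ⟨m, hm⟩ := Nat.even_or_odd' μk
    by_contra! hlt
    obtain ⟨d, hd⟩ : ∃ d, q + 1 = m + d := ⟨q + 1 - m, by omega⟩
    have hds : d ≤ s := by omega
    have hdd : d * d ≤ q := (Nat.mul_le_mul hds hds).trans hs
    rcases hm with rfl | rfl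
    · have hdiv : (2 * m) ^ 2 / 4 = m * m := by
        rw [show (2 * m) ^ 2 = 4 * (m * m) by ring]
        exact Nat.mul_div_cancel_left _ (by norm_num)
      rw [if_pos (even_two_mul m), hdiv] at hμ_spec
      have : 2 * m * (q + 1 + 1) ≤ q * (q + 1) + 2 * m + m * m := by omega
      nlinarith
    · have hdiv : ((2 * m + 1) ^ 2 - 1) / 4 = m * (m + 1) := by
        rw [show (2 * m + 1) ^ 2 = 4 * (m * (m + 1)) + 1 by ring, Nat.add_sub_cancel]
        exact Nat.mul_div_cancel_left _ (by norm_num)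
      rw [if_neg (Nat.not_even_two_mul_add_one m), hdiv] at hμ_spec
      have : (2 * m + 1) * (q + 1 + 1) ≤ q * (q + 1) + (2 * m + 1) + m * (m + 1) := by omega
      nlinarith
  refine ⟨hμ, ?_⟩
  have hceil : ⌈((q * (q + 1) + 1 : ℕ) : ℚ) / ((q + 1 : ℕ) : ℚ)⌉ = (q : ℤ) + 1 := by
    have hq : (0 : ℚ) < (q : ℚ) + 1 := by positivity
    rw [Int.ceil_eq_iff]
    push_cast
    rw [lt_div_iff₀ hq, div_le_iff₀ hq]
    constructor <;> nlinarith
  rw [hceil]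
  push_cast at hμ ⊢
  linarith
end
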